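/- arXiv:2405.15129 — 16 statements merged into one kernel-verified Lean document; each statement's English description precedes it below -/
import Mathlib

section
/- Let h : ℝ^m → ℝ be W-weakly convex with W ≥ 0 and C-Lipschitz (C ≥ 0). Fix y ∈ ℝ^m and real numbers 0 < μ₂ < μ₁ with μ₁·W < 1. Suppose p₁ is a global minimizer over ℝ^m of v ↦ h(v) + ‖v − y‖²/(2μ₁) and p₂ is a global minimizer over ℝ^m of v ↦ h(v) + ‖v − y‖²/(2μ₂). Writing h_{μᵢ}(y) = h(pᵢ) + ‖pᵢ − y‖²/(2μᵢ) for i = 1,2, one has 0 ≤ h_{μ₂}(y) − h_{μ₁}(y) ≤ min(μ₁/(2μ₂), 1) · (μ₁ − μ₂) · C². -/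
/-- Lemma 2 (monotonicity and Lipschitz bound of the Moreau envelope in μ). -/
theorem moreau_envelope_mu_continuity {m : ℕ} (h : EuclideanSpace ℝ (Fin m) → ℝ)
    (W C : ℝ) (hW : 0 ≤ W) (hC : 0 ≤ C)
    (hweak : ConvexOn ℝ Set.univ (fun v => h v + (W / 2) * ‖v‖ ^ 2))
    (hlip : ∀ y y' : EuclideanSpace ℝ (Fin m), |h y - h y'| ≤ C * ‖y - y'‖)
    (y : EuclideanSpace ℝ (Fin m)) (μ₁ μ₂ : ℝ)
    (hμ₂ : 0 < μ₂) (hμ₂₁ : μ₂ < μ₁) (hμW : μ₁ * W < 1)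
    (p₁ p₂ : EuclideanSpace ℝ (Fin m))
    (hp₁ : ∀ v, h p₁ + ‖p₁ - y‖ ^ 2 / (2 * μ₁) ≤ h v + ‖v - y‖ ^ 2 / (2 * μ₁))
    (hp₂ : ∀ v, h p₂ + ‖p₂ - y‖ ^ 2 / (2 * μ₂) ≤ h v + ‖v - y‖ ^ 2 / (2 * μ₂)) :
    0 ≤ (h p₂ + ‖p₂ - y‖ ^ 2 / (2 * μ₂)) - (h p₁ + ‖p₁ - y‖ ^ 2 / (2 * μ₁)) ∧
      (h p₂ + ‖p₂ - y‖ ^ 2 / (2 * μ₂)) - (h p₁ + ‖p₁ - y‖ ^ 2 / (2 * μ₁)) ≤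
        min (μ₁ / (2 * μ₂)) 1 * (μ₁ - μ₂) * C ^ 2 := by
  have hμ₁ : 0 < μ₁ := hμ₂.trans hμ₂₁
  constructor
  · have hcmp : ‖p₂ - y‖ ^ 2 / (2 * μ₁) ≤ ‖p₂ - y‖ ^ 2 / (2 * μ₂) := by gcongr
    linarith [hp₁ p₂]
  · -- Compare `p₂` with the point dividing the segment from `y` to `p₁` in ratio `μ₂ / μ₁`.
    set s : ℝ := μ₂ / μ₁ with hs
    have hs0 : 0 < s := div_pos hμ₂ hμ₁
    have hs1 : s < 1 := (div_lt_one hμ₁).2 hμ₂₁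
    set r : ℝ := ‖p₁ - y‖ with hr
    have hdist : ‖y + s • (p₁ - y) - y‖ = s * r := by
      rw [add_sub_cancel_left, norm_smul, Real.norm_of_nonneg hs0.le]
    have hstep : ‖y + s • (p₁ - y) - p₁‖ = (1 - s) * r := by
      have hvec : y + s • (p₁ - y) - p₁ = -((1 - s) • (p₁ - y)) := by module
      rw [hvec, norm_neg, norm_smul, Real.norm_of_nonneg (by linarith)]
    have hmin := hp₂ (y + s • (p₁ - y))
    have hh := (abs_le.1 (hlip (y + s • (p₁ - y)) p₁)).2
    rw [hdist] at hmin
    rw [hstep] at hh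
    have hid : C * ((1 - s) * r) + (s * r) ^ 2 / (2 * μ₂) - r ^ 2 / (2 * μ₁)
        = (μ₁ - μ₂) * C ^ 2 / 2 - (μ₁ - μ₂) * (C - r / μ₁) ^ 2 / 2 := by
      rw [hs]
      field_simp
      ring
    have hsq : 0 ≤ (μ₁ - μ₂) * (C - r / μ₁) ^ 2 / 2 :=
      div_nonneg (mul_nonneg (by linarith) (sq_nonneg _)) (by norm_num)
    have hhalf : 1 / 2 ≤ min (μ₁ / (2 * μ₂)) 1 := by
      refine le_min ?_ (by norm_num)
      rw [div_le_div_iff₀ (by norm_num) (by positivity)]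
      linarith
    have hmul : 1 / 2 * ((μ₁ - μ₂) * C ^ 2) ≤ min (μ₁ / (2 * μ₂)) 1 * ((μ₁ - μ₂) * C ^ 2) :=
      mul_le_mul_of_nonneg_right hhalf (mul_nonneg (by linarith) (sq_nonneg C))
    rw [mul_assoc]
    linarith
end

section
/- Let h : ℝ^m → ℝ be W-weakly convex with W > 0 and C-Lipschitz (C ≥ 0). Fix y ∈ ℝ^m and real numbers 0 < μ₂ < μ₁ ≤ 1/(2W). Suppose p₁ is a global minimizer over ℝ^m of v ↦ h(v) + ‖v − y‖²/(2μ₁) and p₂ is a global minimizer over ℝ^m of v ↦ h(v) + ‖v − y‖²/(2μ₂). Then ‖(y − p₁)/μ₁ − (y − p₂)/μ₂‖ ≤ (μ₁/μ₂ − 1) · C. -/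
section ProximalPoint

variable {E : Type*} [NormedAddCommGroup E] [InnerProductSpace ℝ E]

lemma le_of_forall_le_add_mul_small {a b c : ℝ}
    (H : ∀ t : ℝ, 0 < t → t ≤ 1 → a ≤ b + t * c) : a ≤ b := by
  have hlim : Filter.Tendsto (fun t : ℝ => b + t * c) (nhdsWithin 0 (Set.Ioi 0)) (nhds b) := by
    have hcont : Continuous fun t : ℝ => b + t * c := by fun_prop
    simpa using (hcont.tendsto 0).mono_left nhdsWithin_le_nhds
  refine ge_of_tendsto hlim ?_
  filter_upwards [Ioc_mem_nhdsGT (zero_lt_one' ℝ)] with t ht using H t ht.1 ht.2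

/-- The scaled residual at a proximal point of a weakly convex function is a proximal
subgradient. -/
lemma inner_le_of_isProximalPoint {h : E → ℝ} {W μ : ℝ} {y p : E}
    (hweak : ConvexOn ℝ Set.univ (fun v => h v + (W / 2) * ‖v‖ ^ 2)) (hμ : 0 < μ)
    (hp : ∀ v, h p + ‖p - y‖ ^ 2 / (2 * μ) ≤ h v + ‖v - y‖ ^ 2 / (2 * μ)) (v : E) :
    inner ℝ (μ⁻¹ • (y - p)) (v - p) ≤ h v - h p + (W / 2) * ‖v - p‖ ^ 2 := by
  apply le_of_forall_le_add_mul_small (c := ‖v - p‖ ^ 2 / (2 * μ) - (W / 2) * ‖v - p‖ ^ 2)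
  intro t ht ht1
  have hconv := hweak.2 (Set.mem_univ p) (Set.mem_univ v) (sub_nonneg.2 ht1) ht.le
    (sub_add_cancel 1 t)
  have hmin := hp ((1 - t) • p + t • v)
  have hnorm : ‖(1 - t) • p + t • v‖ ^ 2
      = (1 - t) * ‖p‖ ^ 2 + t * ‖v‖ ^ 2 - t * (1 - t) * ‖v - p‖ ^ 2 := by
    simp only [← real_inner_self_eq_norm_sq, inner_add_left, inner_add_right, inner_sub_left,
      inner_sub_right, real_inner_smul_left, real_inner_smul_right, real_inner_comm p v]
    ring
  have hdist : ‖(1 - t) • p + t • v - y‖ ^ 2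
      = ‖p - y‖ ^ 2 - 2 * t * inner ℝ (y - p) (v - p) + t ^ 2 * ‖v - p‖ ^ 2 := by
    have hsplit : (1 - t) • p + t • v - y = t • (v - p) - (y - p) := by module
    rw [hsplit, norm_sub_sq_real, norm_smul, real_inner_smul_left, mul_pow, Real.norm_eq_abs,
      sq_abs, norm_sub_rev y p, real_inner_comm]
    ring
  simp only [smul_eq_mul, hnorm] at hconv
  rw [hdist] at hmin
  rw [real_inner_smul_left]
  have hexpand : (‖p - y‖ ^ 2 - 2 * t * inner ℝ (y - p) (v - p) + t ^ 2 * ‖v - p‖ ^ 2) / (2 * μ)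
      = ‖p - y‖ ^ 2 / (2 * μ) - t * (μ⁻¹ * inner ℝ (y - p) (v - p))
        + t ^ 2 * (‖v - p‖ ^ 2 / (2 * μ)) := by
    field_simp
  rw [hexpand] at hmin
  refine le_of_mul_le_mul_left ?_ ht
  linarith

/-- Proximal subgradients of a `C`-Lipschitz function have norm at most `C`. -/
lemma norm_le_of_forall_inner_le {h : E → ℝ} {W C : ℝ} {p g : E} (hC : 0 ≤ C)
    (hlip : ∀ y y', |h y - h y'| ≤ C * ‖y - y'‖)
    (hg : ∀ v, inner ℝ g (v - p) ≤ h v - h p + (W / 2) * ‖v - p‖ ^ 2) : ‖g‖ ≤ C := by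
  have hsq : ‖g‖ ^ 2 ≤ C * ‖g‖ := by
    apply le_of_forall_le_add_mul_small (c := (W / 2) * ‖g‖ ^ 2)
    intro t ht _
    have hsub := hg (p + t • g)
    have hle := (le_abs_self _).trans (hlip (p + t • g) p)
    rw [add_sub_cancel_left, norm_smul, Real.norm_of_nonneg ht.le] at hsub hle
    rw [real_inner_smul_right, real_inner_self_eq_norm_sq] at hsub
    refine le_of_mul_le_mul_left ?_ ht
    linarith
  by_contra! hlt
  nlinarith

end ProximalPoint

/-- Lemma 3 (Lipschitz bound of the Moreau-envelope gradient w.r.t. the smoothing parameter). -/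
theorem moreau_envelope_grad_mu_lipschitz {m : ℕ} (h : EuclideanSpace ℝ (Fin m) → ℝ)
    (W C : ℝ) (hW : 0 < W) (hC : 0 ≤ C)
    (hweak : ConvexOn ℝ Set.univ (fun v => h v + (W / 2) * ‖v‖ ^ 2))
    (hlip : ∀ y y' : EuclideanSpace ℝ (Fin m), |h y - h y'| ≤ C * ‖y - y'‖)
    (y : EuclideanSpace ℝ (Fin m)) (μ₁ μ₂ : ℝ)
    (hμ₂ : 0 < μ₂) (hμ₂₁ : μ₂ < μ₁) (hμW : μ₁ ≤ 1 / (2 * W))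
    (p₁ p₂ : EuclideanSpace ℝ (Fin m))
    (hp₁ : ∀ v, h p₁ + ‖p₁ - y‖ ^ 2 / (2 * μ₁) ≤ h v + ‖v - y‖ ^ 2 / (2 * μ₁))
    (hp₂ : ∀ v, h p₂ + ‖p₂ - y‖ ^ 2 / (2 * μ₂) ≤ h v + ‖v - y‖ ^ 2 / (2 * μ₂)) :
    ‖μ₁⁻¹ • (y - p₁) - μ₂⁻¹ • (y - p₂)‖ ≤ (μ₁ / μ₂ - 1) * C := by
  have hμ₁ : 0 < μ₁ := hμ₂.trans hμ₂₁
  have hsub₁ := inner_le_of_isProximalPoint hweak hμ₁ hp₁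
  have hsub₂ := inner_le_of_isProximalPoint hweak hμ₂ hp₂
  have hg₂ := norm_le_of_forall_inner_le hC hlip hsub₂
  have hmono₁ := hsub₁ p₂
  have hmono₂ := hsub₂ p₁
  have hres₁ : p₁ = y - μ₁ • (μ₁⁻¹ • (y - p₁)) := by
    rw [smul_inv_smul₀ hμ₁.ne', sub_sub_cancel]
  have hres₂ : p₂ = y - μ₂ • (μ₂⁻¹ • (y - p₂)) := by
    rw [smul_inv_smul₀ hμ₂.ne', sub_sub_cancel]
  set g₁ := μ₁⁻¹ • (y - p₁)
  set g₂ := μ₂⁻¹ • (y - p₂)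
  clear_value g₁ g₂
  have hdiff : p₂ - p₁ = μ₁ • (g₁ - g₂) + (μ₁ - μ₂) • g₂ := by
    nth_rewrite 1 [hres₁, hres₂]
    module
  have hmono : inner ℝ (g₁ - g₂) (p₂ - p₁) ≤ W * ‖p₂ - p₁‖ ^ 2 := by
    rw [norm_sub_rev p₁ p₂, ← neg_sub p₂ p₁, inner_neg_right] at hmono₂
    rw [inner_sub_left]
    linarith
  have hμW' : 2 * (μ₁ * W) ≤ 1 := by
    rw [le_div_iff₀ (by positivity)] at hμW
    linarith
  have hcoer : 2 * μ₁ * inner ℝ (g₁ - g₂) (p₂ - p₁) ≤ ‖p₂ - p₁‖ ^ 2 := by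
    nlinarith [mul_le_mul_of_nonneg_left hmono hμ₁.le,
      mul_le_mul_of_nonneg_right hμW' (sq_nonneg ‖p₂ - p₁‖)]
  have hsq : (μ₁ * ‖g₁ - g₂‖) ^ 2 ≤ ((μ₁ - μ₂) * ‖g₂‖) ^ 2 := by
    rw [hdiff, norm_add_sq_real, inner_add_right, real_inner_smul_left, real_inner_smul_right,
      real_inner_smul_right, real_inner_self_eq_norm_sq, norm_smul,
      norm_smul, Real.norm_of_nonneg hμ₁.le, Real.norm_of_nonneg (sub_pos.2 hμ₂₁).le] at hcoer
    linarith
  have hle : μ₁ * ‖g₁ - g₂‖ ≤ (μ₁ - μ₂) * C :=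
    (abs_le_of_sq_le_sq' hsq (mul_nonneg (sub_pos.2 hμ₂₁).le (norm_nonneg _))).2.trans
      (mul_le_mul_of_nonneg_left hg₂ (sub_pos.2 hμ₂₁).le)
  have hμ₂le : μ₂ * ‖g₁ - g₂‖ ≤ (μ₁ - μ₂) * C :=
    (mul_le_mul_of_nonneg_right hμ₂₁.le (norm_nonneg _)).trans hle
  rw [div_sub_one hμ₂.ne', div_mul_eq_mul_div, le_div_iff₀ hμ₂]
  linarith
end

section
/- Let h : ℝ^m → ℝ be W-weakly convex with W ≥ 0, let μ > 0 satisfy μ·W ≤ 1/2, let β > 1/μ, and let b ∈ ℝ^m. Suppose the pair (ȳ, y̆) ∈ ℝ^m × ℝ^m is a global minimizer of (y, y') ↦ h(y') + ‖y' − y‖²/(2μ) + (β/2)‖y − b‖². Then ȳ = (y̆ + μβ·b)/(1 + μβ), and y̆ is a global minimizer over ℝ^m of y' ↦ h(y') + (β/(2(1 + μβ)))·‖y' − b‖². -/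
/-- Completing the square in the variable `y` shared by two quadratic penalties. -/
lemma sq_dist_add_sq_dist_eq {E : Type*} [NormedAddCommGroup E] [InnerProductSpace ℝ E]
    {μ β : ℝ} (hμ : μ ≠ 0) (hμβ : 1 + μ * β ≠ 0) (b y z : E) :
    ‖z - y‖ ^ 2 / (2 * μ) + (β / 2) * ‖y - b‖ ^ 2 =
      (β / (2 * (1 + μ * β))) * ‖z - b‖ ^ 2 +
        ((1 + μ * β) / (2 * μ)) * ‖y - (1 / (1 + μ * β)) • (z + (μ * β) • b)‖ ^ 2 := by
  have hzy : z - y = (z - b) - (y - b) := by abel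
  have hcenter : y - (1 / (1 + μ * β)) • (z + (μ * β) • b) =
      (y - b) - (1 / (1 + μ * β)) • (z - b) := by
    match_scalars <;> field_simp <;> ring
  rw [hcenter, hzy, norm_sub_sq_real (z - b), norm_sub_sq_real (y - b), norm_smul,
    inner_smul_right, mul_pow, Real.norm_eq_abs, sq_abs, real_inner_comm (y - b) (z - b)]
  field_simp
  ring


/-- Lemma 4(a) (structure of the joint proximal minimizer of the Moreau-envelope problem). -/
theorem moreau_prox_structure {m : ℕ} (h : EuclideanSpace ℝ (Fin m) → ℝ)
    (W : ℝ) (hW : 0 ≤ W)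
    (hweak : ConvexOn ℝ Set.univ (fun v => h v + (W / 2) * ‖v‖ ^ 2))
    (μ β : ℝ) (hμ : 0 < μ) (hμW : μ * W ≤ 1 / 2) (hβ : 1 / μ < β)
    (b ybar ybreve : EuclideanSpace ℝ (Fin m))
    (hmin : ∀ y y' : EuclideanSpace ℝ (Fin m),
      h ybreve + ‖ybreve - ybar‖ ^ 2 / (2 * μ) + (β / 2) * ‖ybar - b‖ ^ 2 ≤
        h y' + ‖y' - y‖ ^ 2 / (2 * μ) + (β / 2) * ‖y - b‖ ^ 2) :
    ybar = (1 / (1 + μ * β)) • (ybreve + (μ * β) • b) ∧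
      ∀ y' : EuclideanSpace ℝ (Fin m),
        h ybreve + (β / (2 * (1 + μ * β))) * ‖ybreve - b‖ ^ 2 ≤
          h y' + (β / (2 * (1 + μ * β))) * ‖y' - b‖ ^ 2 := by
  have hβ' : 0 < β := (one_div_pos.mpr hμ).trans hβ
  have hμβ : 0 < 1 + μ * β := by positivity
  have hcoef : 0 < (1 + μ * β) / (2 * μ) := by positivity
  have hmin' (y y' : EuclideanSpace ℝ (Fin m)) := hmin y y'
  simp only [add_assoc, sq_dist_add_sq_dist_eq hμ.ne' hμβ.ne'] at hmin'
  have hbar : ybar = (1 / (1 + μ * β)) • (ybreve + (μ * β) • b) := by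
    have hle := hmin' ((1 / (1 + μ * β)) • (ybreve + (μ * β) • b)) ybreve
    simp only [sub_self, norm_zero, ne_eq, OfNat.ofNat_ne_zero, not_false_eq_true, zero_pow,
      mul_zero, add_zero, add_le_add_iff_left, add_le_iff_nonpos_right] at hle
    rw [← sub_eq_zero, ← norm_eq_zero, ← sq_eq_zero_iff]
    exact le_antisymm (nonpos_of_mul_nonpos_right hle hcoef) (sq_nonneg _)
  refine ⟨hbar, fun y' ↦ ?_⟩
  have hle := hmin' ((1 / (1 + μ * β)) • (y' + (μ * β) • b)) y'
  rw [← hbar] at hle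
  simpa using hle
end

section
/- Let h : ℝ^m → ℝ be W-weakly convex with W ≥ 0 and C-Lipschitz (C ≥ 0), let μ > 0 satisfy μ·W ≤ 1/2, let β > 1/μ, and let b ∈ ℝ^m. Suppose the pair (ȳ, y̆) ∈ ℝ^m × ℝ^m is a global minimizer of (y, y') ↦ h(y') + ‖y' − y‖²/(2μ) + (β/2)‖y − b‖². Then ‖ȳ − y̆‖ ≤ μ·C. -/
/-- Lemma 4(c) (distance between the two components of the joint proximal minimizer). -/
theorem moreau_prox_distance {m : ℕ} (h : EuclideanSpace ℝ (Fin m) → ℝ)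
    (W C : ℝ) (hW : 0 ≤ W) (hC : 0 ≤ C)
    (hweak : ConvexOn ℝ Set.univ (fun v => h v + (W / 2) * ‖v‖ ^ 2))
    (hlip : ∀ y y' : EuclideanSpace ℝ (Fin m), |h y - h y'| ≤ C * ‖y - y'‖)
    (μ β : ℝ) (hμ : 0 < μ) (hμW : μ * W ≤ 1 / 2) (hβ : 1 / μ < β)
    (b ybar ybreve : EuclideanSpace ℝ (Fin m))
    (hmin : ∀ y y' : EuclideanSpace ℝ (Fin m),
      h ybreve + ‖ybreve - ybar‖ ^ 2 / (2 * μ) + (β / 2) * ‖ybar - b‖ ^ 2 ≤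
        h y' + ‖y' - y‖ ^ 2 / (2 * μ) + (β / 2) * ‖y - b‖ ^ 2) :
    ‖ybar - ybreve‖ ≤ μ * C := by
  by_contra! hlt
  set d := ‖ybar - ybreve‖ with hd
  have hμC : 0 ≤ μ * C := mul_nonneg hμ.le hC
  have hdpos : 0 < d := hμC.trans_lt hlt
  obtain ⟨t, ht⟩ : ∃ t, t = (d - μ * C) / d := ⟨_, rfl⟩
  have htd : t * d = d - μ * C := by rw [ht]; field_simp
  have ht0 : 0 < t := by rw [ht]; exact div_pos (sub_pos.2 hlt) hdpos
  have hm := hmin ybar (ybreve + t • (ybar - ybreve))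
  have hdist : ‖ybreve + t • (ybar - ybreve) - ybar‖ ^ 2 = (1 - t) ^ 2 * d ^ 2 := by
    have e : ybreve + t • (ybar - ybreve) - ybar = (t - 1) • (ybar - ybreve) := by module
    rw [e, norm_smul, mul_pow, Real.norm_eq_abs, sq_abs, ← hd]
    ring
  have hl := (le_abs_self _).trans (hlip (ybreve + t • (ybar - ybreve)) ybreve)
  rw [add_sub_cancel_left, norm_smul, Real.norm_of_nonneg ht0.le, ← hd] at hl
  rw [hdist, norm_sub_rev ybreve ybar, ← hd] at hm
  have hdiff : d ^ 2 / (2 * μ) - (1 - t) ^ 2 * d ^ 2 / (2 * μ) ≤ C * (t * d) := by linarith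
  rw [← sub_div, div_le_iff₀ (by positivity)] at hdiff
  have hprod : t * d * (d - μ * C) ≤ 0 := by
    linear_combination hdiff + (t * d) * htd
  exact (mul_pos (mul_pos ht0 hdpos) (sub_pos.2 hlt)).not_ge hprod
end

section
/- Let ρ > 0, let X be a real n×r matrix with XᵀX = I_r, and let G be any real n×r matrix. Define D_ρ = G − ρ·X·Gᵀ·X − (1 − ρ)·X·Xᵀ·G. Then max(1, 2ρ)·⟨G, D_ρ⟩ ≥ ‖D_ρ‖_F² and ‖D_ρ‖_F² ≥ min(1, ρ²)·‖D_1‖_F², where D_1 = G − X·Gᵀ·X and ⟨A, B⟩ = trace(AᵀB). -/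
open Matrix

/-- The Frobenius norm of a real matrix. -/
noncomputable def frobeniusNorm {n r : ℕ} (A : Matrix (Fin n) (Fin r) ℝ) : ℝ :=
  Real.sqrt (∑ i, ∑ j, A i j ^ 2)

theorem frobeniusNorm_sq {n r : ℕ} (A : Matrix (Fin n) (Fin r) ℝ) :
    frobeniusNorm A ^ 2 = ∑ i, ∑ j, A i j ^ 2 :=
  Real.sq_sqrt (Finset.sum_nonneg fun _ _ => Finset.sum_nonneg fun _ _ => sq_nonneg _)

theorem frobeniusNorm_sq_eq_trace {n r : ℕ} (A : Matrix (Fin n) (Fin r) ℝ) :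
    frobeniusNorm A ^ 2 = trace (Aᵀ * A) := by
  rw [frobeniusNorm_sq, Finset.sum_comm]
  simp [trace, mul_apply, sq]

/-- The search direction splits into a normal part and a tangential part `X * S`, `S` skew. -/
theorem search_direction_eq {n r : ℕ} (ρ : ℝ) (X G : Matrix (Fin n) (Fin r) ℝ) :
    G - ρ • (X * Gᵀ * X) - (1 - ρ) • (X * Xᵀ * G) =
      (G - X * Xᵀ * G) + ρ • (X * (Xᵀ * G - Gᵀ * X)) := by
  simp only [Matrix.mul_sub, Matrix.mul_assoc]
  module

theorem transpose_mul_normal_part {n r : ℕ} (X G : Matrix (Fin n) (Fin r) ℝ)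
    (hX : Xᵀ * X = 1) : Xᵀ * (G - X * Xᵀ * G) = 0 := by
  rw [Matrix.mul_sub, Matrix.mul_assoc X, ← Matrix.mul_assoc, hX, Matrix.one_mul, sub_self]

theorem frobeniusNorm_add_smul_mul_sq {n r : ℕ} (ρ : ℝ) (X P : Matrix (Fin n) (Fin r) ℝ)
    (S : Matrix (Fin r) (Fin r) ℝ) (hX : Xᵀ * X = 1) (hP : Xᵀ * P = 0) :
    frobeniusNorm (P + ρ • (X * S)) ^ 2 =
      frobeniusNorm P ^ 2 + ρ ^ 2 * frobeniusNorm S ^ 2 := by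
  have hP' : Pᵀ * X = 0 := by simpa using congrArg transpose hP
  have h₁ : Pᵀ * (X * S) = 0 := by rw [← Matrix.mul_assoc, hP', Matrix.zero_mul]
  have h₂ : Sᵀ * Xᵀ * P = 0 := by rw [Matrix.mul_assoc, hP, Matrix.mul_zero]
  have h₃ : Sᵀ * Xᵀ * (X * S) = Sᵀ * S := by
    rw [Matrix.mul_assoc, ← Matrix.mul_assoc Xᵀ, hX, Matrix.one_mul]
  simp only [frobeniusNorm_sq_eq_trace, transpose_add, transpose_smul, transpose_mul,
    Matrix.add_mul, Matrix.mul_add, Matrix.smul_mul, Matrix.mul_smul, h₁, h₂, h₃, trace_add,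
    trace_smul, smul_eq_mul, trace_zero]
  ring

theorem trace_transpose_mul_normal_part {n r : ℕ} (X G : Matrix (Fin n) (Fin r) ℝ)
    (hX : Xᵀ * X = 1) :
    trace (Gᵀ * (G - X * Xᵀ * G)) = frobeniusNorm (G - X * Xᵀ * G) ^ 2 := by
  have h : (X * Xᵀ * G)ᵀ * (G - X * Xᵀ * G) = 0 := by
    rw [transpose_mul, transpose_mul, transpose_transpose, Matrix.mul_assoc, Matrix.mul_assoc,
      transpose_mul_normal_part X G hX, Matrix.mul_zero, Matrix.mul_zero]
  rw [frobeniusNorm_sq_eq_trace, transpose_sub, Matrix.sub_mul, h, sub_zero]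

theorem two_mul_trace_transpose_mul_skew {r : ℕ} (A : Matrix (Fin r) (Fin r) ℝ) :
    2 * trace (Aᵀ * (A - Aᵀ)) = frobeniusNorm (A - Aᵀ) ^ 2 := by
  have h : trace (Aᵀ * Aᵀ) = trace (A * A) := by rw [← transpose_mul, trace_transpose]
  simp only [frobeniusNorm_sq_eq_trace, transpose_sub, transpose_transpose, Matrix.mul_sub,
    Matrix.sub_mul, trace_sub, h, trace_mul_comm A Aᵀ]
  ring

/-- Lemma 6(a): bounds relating the search direction D_ρ to G and to D_1. -/
theorem search_direction_bounds {n r : ℕ} (ρ : ℝ) (hρ : 0 < ρ)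
    (X G : Matrix (Fin n) (Fin r) ℝ) (hX : Xᵀ * X = 1) :
    max 1 (2 * ρ) *
        Matrix.trace (Gᵀ * (G - ρ • (X * Gᵀ * X) - (1 - ρ) • (X * Xᵀ * G))) ≥
      frobeniusNorm (G - ρ • (X * Gᵀ * X) - (1 - ρ) • (X * Xᵀ * G)) ^ 2 ∧
    frobeniusNorm (G - ρ • (X * Gᵀ * X) - (1 - ρ) • (X * Xᵀ * G)) ^ 2 ≥
      min 1 (ρ ^ 2) * frobeniusNorm (G - X * Gᵀ * X) ^ 2 := by
  have hD₁ : G - X * Gᵀ * X = (G - X * Xᵀ * G) + (1 : ℝ) • (X * (Xᵀ * G - Gᵀ * X)) := by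
    simpa using search_direction_eq 1 X G
  have hP := transpose_mul_normal_part X G hX
  have hS : 2 * trace (Gᵀ * (X * (Xᵀ * G - Gᵀ * X))) =
      frobeniusNorm (Xᵀ * G - Gᵀ * X) ^ 2 := by
    simpa [Matrix.mul_assoc] using two_mul_trace_transpose_mul_skew (Xᵀ * G)
  rw [search_direction_eq, hD₁, frobeniusNorm_add_smul_mul_sq _ _ _ _ hX hP,
    frobeniusNorm_add_smul_mul_sq _ _ _ _ hX hP, Matrix.mul_add, Matrix.mul_smul, trace_add,
    trace_smul, trace_transpose_mul_normal_part X G hX, smul_eq_mul]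
  have hp := sq_nonneg (frobeniusNorm (G - X * Xᵀ * G))
  have hs := sq_nonneg (frobeniusNorm (Xᵀ * G - Gᵀ * X))
  constructor
  · have h₁ := mul_le_mul_of_nonneg_right (le_max_left 1 (2 * ρ)) hp
    have h₂ := mul_le_mul_of_nonneg_right (le_max_right 1 (2 * ρ)) (mul_nonneg hρ.le hs)
    rw [← hS] at h₂ ⊢
    linarith
  · have h₁ := mul_le_mul_of_nonneg_right (min_le_left 1 (ρ ^ 2)) hp
    have h₂ := mul_le_mul_of_nonneg_right (min_le_right 1 (ρ ^ 2)) hs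
    linarith
end

section
/- Let ρ > 0, let X be a real n×r matrix with XᵀX = I_r, and let G be any real n×r matrix. Define D_ρ = G − ρ·X·Gᵀ·X − (1 − ρ)·X·Xᵀ·G. Then min(1, 2ρ)·‖D_{1/2}‖_F ≤ ‖D_ρ‖_F ≤ max(1, 2ρ)·‖D_{1/2}‖_F, where D_{1/2} = G − (1/2)·X·Gᵀ·X − (1/2)·X·Xᵀ·G. -/
open Matrix

/-- Pythagoras for matrices with columnwise orthogonality `Aᵀ * B = 0`. -/
theorem frobeniusNorm_add_smul_of_transpose_mul_eq_zero {n r : ℕ}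
    {A B : Matrix (Fin n) (Fin r) ℝ} (h : Aᵀ * B = 0) (c : ℝ) :
    frobeniusNorm (A + c • B) =
      Real.sqrt (∑ i, ∑ j, A i j ^ 2 + c ^ 2 * ∑ i, ∑ j, B i j ^ 2) := by
  have cross : ∑ i, ∑ j, A i j * B i j = 0 := by
    rw [Finset.sum_comm]
    refine Finset.sum_eq_zero fun j _ => ?_
    simpa [Matrix.mul_apply] using congrFun (congrFun h j) j
  have expand : ∑ i, ∑ j, (A + c • B) i j ^ 2 =
      ∑ i, ∑ j, A i j ^ 2 + 2 * c * ∑ i, ∑ j, A i j * B i j +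
        c ^ 2 * ∑ i, ∑ j, B i j ^ 2 := by
    simp only [Finset.mul_sum, ← Finset.sum_add_distrib]
    refine Finset.sum_congr rfl fun i _ => Finset.sum_congr rfl fun j _ => ?_
    simp only [Matrix.add_apply, Matrix.smul_apply, smul_eq_mul]
    ring
  rw [frobeniusNorm, expand, cross, mul_zero, add_zero]

/-- The search direction splits into its normal part and `ρ` times its tangential part. -/
theorem search_direction_eq_add_smul {n r : ℕ} (ρ : ℝ) (X G : Matrix (Fin n) (Fin r) ℝ) :
    G - ρ • (X * Gᵀ * X) - (1 - ρ) • (X * Xᵀ * G) =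
      (G - X * Xᵀ * G) + ρ • (X * Xᵀ * G - X * Gᵀ * X) := by
  module

theorem transpose_sub_projection_mul_eq_zero {n r : ℕ} (X G : Matrix (Fin n) (Fin r) ℝ)
    (hX : Xᵀ * X = 1) : (G - X * Xᵀ * G)ᵀ * (X * Xᵀ * G - X * Gᵀ * X) = 0 := by
  have h : (G - X * Xᵀ * G)ᵀ * X = 0 := by
    simp [Matrix.transpose_mul, Matrix.sub_mul, Matrix.mul_assoc, hX]
  simp only [Matrix.mul_sub, ← Matrix.mul_assoc]
  simp only [h, Matrix.zero_mul, sub_self]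

/-- Lemma 6(b): two-sided bound of ‖D_ρ‖_F by ‖D_{1/2}‖_F. -/
theorem search_direction_half_bounds {n r : ℕ} (ρ : ℝ) (hρ : 0 < ρ)
    (X G : Matrix (Fin n) (Fin r) ℝ) (hX : Xᵀ * X = 1) :
    min 1 (2 * ρ) *
        frobeniusNorm (G - (1 / 2 : ℝ) • (X * Gᵀ * X) - (1 / 2 : ℝ) • (X * Xᵀ * G)) ≤
      frobeniusNorm (G - ρ • (X * Gᵀ * X) - (1 - ρ) • (X * Xᵀ * G)) ∧
    frobeniusNorm (G - ρ • (X * Gᵀ * X) - (1 - ρ) • (X * Xᵀ * G)) ≤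
      max 1 (2 * ρ) *
        frobeniusNorm (G - (1 / 2 : ℝ) • (X * Gᵀ * X) - (1 / 2 : ℝ) • (X * Xᵀ * G)) := by
  have half : G - (1 / 2 : ℝ) • (X * Gᵀ * X) - (1 / 2 : ℝ) • (X * Xᵀ * G) =
      (G - X * Xᵀ * G) + (1 / 2 : ℝ) • (X * Xᵀ * G - X * Gᵀ * X) := by
    module
  have orth := transpose_sub_projection_mul_eq_zero X G hX
  rw [half, search_direction_eq_add_smul,
    frobeniusNorm_add_smul_of_transpose_mul_eq_zero orth,
    frobeniusNorm_add_smul_of_transpose_mul_eq_zero orth]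
  have ha : 0 ≤ ∑ i, ∑ j, (G - X * Xᵀ * G) i j ^ 2 := by positivity
  have hb : 0 ≤ ∑ i, ∑ j, (X * Xᵀ * G - X * Gᵀ * X) i j ^ 2 := by positivity
  generalize ∑ i, ∑ j, (G - X * Xᵀ * G) i j ^ 2 = a at ha ⊢
  generalize ∑ i, ∑ j, (X * Xᵀ * G - X * Gᵀ * X) i j ^ 2 = b at hb ⊢
  have hm : 0 ≤ min 1 (2 * ρ) := by positivity
  have hM : 0 ≤ max 1 (2 * ρ) := by positivity
  have scale {m : ℝ} (hm : 0 ≤ m) :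
      m * Real.sqrt (a + (1 / 2) ^ 2 * b) = Real.sqrt (m ^ 2 * a + (m / 2) ^ 2 * b) := by
    rw [show m ^ 2 * a + (m / 2) ^ 2 * b = m ^ 2 * (a + (1 / 2) ^ 2 * b) by ring,
      Real.sqrt_mul (sq_nonneg m), Real.sqrt_sq hm]
  rw [scale hm, scale hM]
  constructor
  · have h₁ : min 1 (2 * ρ) ^ 2 ≤ 1 := pow_le_one₀ hm (min_le_left _ _)
    have h₂ : min 1 (2 * ρ) / 2 ≤ ρ := by linarith [min_le_right 1 (2 * ρ)]
    gcongr
    exact mul_le_of_le_one_left ha h₁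
  · have h₁ : 1 ≤ max 1 (2 * ρ) ^ 2 := one_le_pow₀ (le_max_left _ _)
    have h₂ : ρ ≤ max 1 (2 * ρ) / 2 := by linarith [le_max_right 1 (2 * ρ)]
    gcongr
    exact le_mul_of_one_le_left ha h₁
end

section
/- Let X be a real n×r matrix with XᵀX = I_r and let G be any real n×r matrix. Then ‖G − (1/2)·X·(GᵀX + XᵀG)‖_F ≤ ‖G − X·Gᵀ·X‖_F. -/
open Matrix

theorem sum_sum_sq_eq_trace_transpose_mul_self {m n : Type*} [Fintype m] [Fintype n]
    (A : Matrix m n ℝ) : ∑ i, ∑ j, A i j ^ 2 = (Aᵀ * A).trace := by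
  rw [Finset.sum_comm]
  simp [Matrix.trace, Matrix.mul_apply, sq]

theorem trace_transpose_mul_self_nonneg {m n : Type*} [Fintype m] [Fintype n]
    (A : Matrix m n ℝ) : 0 ≤ (Aᵀ * A).trace := by
  rw [← sum_sum_sq_eq_trace_transpose_mul_self]
  positivity

/-- Adding `X Xᵀ P` to `P` does not decrease the Frobenius norm, as `X Xᵀ` is positive
semidefinite. -/
theorem frobeniusNorm_le_frobeniusNorm_add_mul_transpose_mul {n r k : ℕ}
    (P : Matrix (Fin n) (Fin r) ℝ) (X : Matrix (Fin n) (Fin k) ℝ) :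
    frobeniusNorm P ≤ frobeniusNorm (P + X * (Xᵀ * P)) := by
  refine Real.sqrt_le_sqrt ?_
  rw [sum_sum_sq_eq_trace_transpose_mul_self, sum_sum_sq_eq_trace_transpose_mul_self]
  have expand : (P + X * (Xᵀ * P))ᵀ * (P + X * (Xᵀ * P)) =
      Pᵀ * P + (2 : ℝ) • ((Xᵀ * P)ᵀ * (Xᵀ * P)) +
        (X * (Xᵀ * P))ᵀ * (X * (Xᵀ * P)) := by
    simp only [transpose_add, transpose_mul, transpose_transpose, Matrix.add_mul,
      Matrix.mul_add, Matrix.mul_assoc, two_smul]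
    abel
  rw [expand, trace_add, trace_add, trace_smul, smul_eq_mul]
  linarith [trace_transpose_mul_self_nonneg (Xᵀ * P),
    trace_transpose_mul_self_nonneg (X * (Xᵀ * P))]

/-- Lemma 7: the tangent-space projection of G is bounded by the Riemannian-gradient
matrix G − X Gᵀ X in Frobenius norm. -/
theorem proj_tangent_le_riemannian_grad {n r : ℕ} (X G : Matrix (Fin n) (Fin r) ℝ)
    (hX : Xᵀ * X = 1) :
    frobeniusNorm (G - (1 / 2 : ℝ) • (X * (Gᵀ * X + Xᵀ * G))) ≤
      frobeniusNorm (G - X * Gᵀ * X) := by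
  have key : G - X * Gᵀ * X = (G - (1 / 2 : ℝ) • (X * (Gᵀ * X + Xᵀ * G))) +
      X * (Xᵀ * (G - (1 / 2 : ℝ) • (X * (Gᵀ * X + Xᵀ * G)))) := by
    rw [Matrix.mul_sub, Matrix.mul_smul, ← Matrix.mul_assoc Xᵀ X, hX, Matrix.one_mul,
      Matrix.mul_sub, Matrix.mul_smul, Matrix.mul_add, Matrix.mul_assoc]
    module
  rw [key]
  exact frobeniusNorm_le_frobeniusNorm_add_mul_transpose_mul _ X
end

section
/- Let P, P̃ ∈ ℝ^{n×r} be arbitrary and let X, X̃ ∈ ℝ^{n×r} satisfy XᵀX = I_r and X̃ᵀX̃ = I_r. Then ‖Proj_X(P) − Proj_{X̃}(P̃)‖_F ≤ 2·‖P − P̃‖_F + 2·√r·‖P‖₂·‖X − X̃‖_F, where ‖P‖₂ denotes the spectral norm (ℓ₂ operator norm) of P. -/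
open Matrix

/-- The spectral norm (ℓ₂ operator norm) of a real matrix. -/
noncomputable def spectralNorm' {n r : ℕ} (A : Matrix (Fin n) (Fin r) ℝ) : ℝ :=
  ‖LinearMap.toContinuousLinearMap (Matrix.toEuclideanLin A)‖

section Norms

open scoped Matrix.Norms.L2Operator

theorem spectralNorm'_eq_l2_opNorm {n r : ℕ} (A : Matrix (Fin n) (Fin r) ℝ) :
    spectralNorm' A = ‖A‖ := rfl

theorem spectralNorm'_nonneg {n r : ℕ} (A : Matrix (Fin n) (Fin r) ℝ) :
    0 ≤ spectralNorm' A := norm_nonneg _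

theorem spectralNorm'_add_le {n r : ℕ} (A B : Matrix (Fin n) (Fin r) ℝ) :
    spectralNorm' (A + B) ≤ spectralNorm' A + spectralNorm' B := by
  simpa only [spectralNorm'_eq_l2_opNorm] using norm_add_le A B

theorem spectralNorm'_mul_le {l n r : ℕ} (A : Matrix (Fin l) (Fin n) ℝ)
    (B : Matrix (Fin n) (Fin r) ℝ) :
    spectralNorm' (A * B) ≤ spectralNorm' A * spectralNorm' B := by
  simpa only [spectralNorm'_eq_l2_opNorm] using Matrix.l2_opNorm_mul A B

theorem spectralNorm'_transpose {n r : ℕ} (A : Matrix (Fin n) (Fin r) ℝ) :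
    spectralNorm' Aᵀ = spectralNorm' A := by
  simpa only [spectralNorm'_eq_l2_opNorm, conjTranspose_eq_transpose_of_trivial] using
    Matrix.l2_opNorm_conjTranspose A

theorem spectralNorm'_le_one_of_orthonormal {n r : ℕ} {X : Matrix (Fin n) (Fin r) ℝ}
    (hX : Xᵀ * X = 1) : spectralNorm' X ≤ 1 := by
  have h := Matrix.l2_opNorm_conjTranspose_mul_self X
  rw [conjTranspose_eq_transpose_of_trivial, hX, ← diagonal_one, Matrix.l2_opNorm_diagonal] at h
  have h_one : ‖(1 : Fin r → ℝ)‖ ≤ 1 :=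
    (pi_norm_le_iff_of_nonneg zero_le_one).2 fun _ => by simp
  rw [spectralNorm'_eq_l2_opNorm]
  have h' : ‖X‖ * ‖X‖ ≤ 1 := h ▸ h_one
  nlinarith [norm_nonneg X]

theorem sum_sq_mulVec_le {n r : ℕ} (A : Matrix (Fin n) (Fin r) ℝ) (v : Fin r → ℝ) :
    ∑ i, (A *ᵥ v) i ^ 2 ≤ spectralNorm' A ^ 2 * ∑ j, v j ^ 2 := by
  have h := pow_le_pow_left₀ (norm_nonneg _) (Matrix.l2_opNorm_mulVec A (WithLp.toLp 2 v)) 2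
  rw [mul_pow, EuclideanSpace.real_norm_sq_eq, EuclideanSpace.real_norm_sq_eq] at h
  exact h

end Norms

section Frobenius

attribute [local instance] Matrix.frobeniusNormedAddCommGroup Matrix.frobeniusNormedSpace

theorem frobeniusNorm_eq_norm {n r : ℕ} (A : Matrix (Fin n) (Fin r) ℝ) :
    frobeniusNorm A = ‖A‖ := by
  rw [Matrix.frobenius_norm_def, frobeniusNorm, Real.sqrt_eq_rpow]
  simp

theorem frobeniusNorm_add_le {n r : ℕ} (A B : Matrix (Fin n) (Fin r) ℝ) :
    frobeniusNorm (A + B) ≤ frobeniusNorm A + frobeniusNorm B := by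
  simpa only [frobeniusNorm_eq_norm] using norm_add_le A B

theorem frobeniusNorm_sub_le {n r : ℕ} (A B : Matrix (Fin n) (Fin r) ℝ) :
    frobeniusNorm (A - B) ≤ frobeniusNorm A + frobeniusNorm B := by
  simpa only [frobeniusNorm_eq_norm] using norm_sub_le A B

theorem frobeniusNorm_smul {n r : ℕ} (c : ℝ) (A : Matrix (Fin n) (Fin r) ℝ) :
    frobeniusNorm (c • A) = |c| * frobeniusNorm A := by
  simpa only [frobeniusNorm_eq_norm, Real.norm_eq_abs] using norm_smul c A

end Frobenius

theorem frobeniusNorm_nonneg {n r : ℕ} (A : Matrix (Fin n) (Fin r) ℝ) :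
    0 ≤ frobeniusNorm A := Real.sqrt_nonneg _

theorem frobeniusNorm_transpose {n r : ℕ} (A : Matrix (Fin n) (Fin r) ℝ) :
    frobeniusNorm Aᵀ = frobeniusNorm A := by
  unfold frobeniusNorm
  rw [Finset.sum_comm]
  rfl

theorem frobeniusNorm_mul_le_spectralNorm'_mul {l n r : ℕ} (A : Matrix (Fin l) (Fin n) ℝ)
    (B : Matrix (Fin n) (Fin r) ℝ) :
    frobeniusNorm (A * B) ≤ spectralNorm' A * frobeniusNorm B := by
  unfold frobeniusNorm
  rw [← Real.sqrt_sq (spectralNorm'_nonneg A), ← Real.sqrt_mul (sq_nonneg _)]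
  refine Real.sqrt_le_sqrt ?_
  rw [Finset.sum_comm, Finset.sum_comm (f := fun i j => B i j ^ 2), Finset.mul_sum]
  exact Finset.sum_le_sum fun j _ => sum_sq_mulVec_le A fun i => B i j

theorem frobeniusNorm_mul_le_mul_spectralNorm' {l n r : ℕ} (A : Matrix (Fin l) (Fin n) ℝ)
    (B : Matrix (Fin n) (Fin r) ℝ) :
    frobeniusNorm (A * B) ≤ frobeniusNorm A * spectralNorm' B := by
  have h := frobeniusNorm_mul_le_spectralNorm'_mul Bᵀ Aᵀ
  rwa [← transpose_mul, frobeniusNorm_transpose, frobeniusNorm_transpose,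
    spectralNorm'_transpose, mul_comm] at h

theorem frobeniusNorm_mul_le_of_orthonormal {n r m : ℕ} {X : Matrix (Fin n) (Fin r) ℝ}
    (hX : Xᵀ * X = 1) (B : Matrix (Fin r) (Fin m) ℝ) :
    frobeniusNorm (X * B) ≤ frobeniusNorm B :=
  (frobeniusNorm_mul_le_spectralNorm'_mul X B).trans <|
    mul_le_of_le_one_left (frobeniusNorm_nonneg B) (spectralNorm'_le_one_of_orthonormal hX)

theorem frobeniusNorm_transpose_mul_add_le {n r : ℕ} (A B : Matrix (Fin n) (Fin r) ℝ) :
    frobeniusNorm (Aᵀ * B + Bᵀ * A) ≤ 2 * (spectralNorm' A * frobeniusNorm B) := by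
  have h₁ := frobeniusNorm_mul_le_spectralNorm'_mul Aᵀ B
  have h₂ := frobeniusNorm_mul_le_mul_spectralNorm' Bᵀ A
  rw [spectralNorm'_transpose] at h₁
  rw [frobeniusNorm_transpose] at h₂
  linarith [frobeniusNorm_add_le (Aᵀ * B) (Bᵀ * A)]

theorem spectralNorm'_transpose_mul_add_le {n r : ℕ} (A B : Matrix (Fin n) (Fin r) ℝ) :
    spectralNorm' (Aᵀ * B + Bᵀ * A) ≤ 2 * (spectralNorm' A * spectralNorm' B) := by
  have h₁ := spectralNorm'_mul_le Aᵀ B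
  have h₂ := spectralNorm'_mul_le Bᵀ A
  rw [spectralNorm'_transpose] at h₁ h₂
  linarith [spectralNorm'_add_le (Aᵀ * B) (Bᵀ * A)]

/-- The tangent-space projection at a point of the Stiefel manifold at most doubles the
Frobenius norm. -/
theorem frobeniusNorm_proj_le {n r : ℕ} (D : Matrix (Fin n) (Fin r) ℝ)
    {X : Matrix (Fin n) (Fin r) ℝ} (hX : Xᵀ * X = 1) :
    frobeniusNorm (D - (1 / 2 : ℝ) • (X * (Dᵀ * X + Xᵀ * D))) ≤ 2 * frobeniusNorm D := by
  have h₁ := frobeniusNorm_sub_le D ((1 / 2 : ℝ) • (X * (Dᵀ * X + Xᵀ * D)))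
  rw [frobeniusNorm_smul, abs_of_nonneg (by norm_num)] at h₁
  have h₂ := frobeniusNorm_mul_le_of_orthonormal hX (Dᵀ * X + Xᵀ * D)
  have h₃ := frobeniusNorm_transpose_mul_add_le X D
  rw [add_comm] at h₃
  have h₄ := mul_le_of_le_one_left (frobeniusNorm_nonneg D)
    (spectralNorm'_le_one_of_orthonormal hX)
  linarith

theorem frobeniusNorm_mul_sym_sub_le {n r : ℕ} (P : Matrix (Fin n) (Fin r) ℝ)
    {X Y : Matrix (Fin n) (Fin r) ℝ} (hX : Xᵀ * X = 1) (hY : Yᵀ * Y = 1) :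
    frobeniusNorm (X * (Pᵀ * X + Xᵀ * P) - Y * (Pᵀ * Y + Yᵀ * P)) ≤
      4 * (spectralNorm' P * frobeniusNorm (X - Y)) := by
  have h_split : X * (Pᵀ * X + Xᵀ * P) - Y * (Pᵀ * Y + Yᵀ * P) =
      (X - Y) * (Pᵀ * X + Xᵀ * P) + Y * (Pᵀ * (X - Y) + (X - Y)ᵀ * P) := by
    simp only [transpose_sub, Matrix.mul_add, Matrix.mul_sub, Matrix.sub_mul]
    abel
  rw [h_split]
  have h₁ := frobeniusNorm_mul_le_mul_spectralNorm' (X - Y) (Pᵀ * X + Xᵀ * P)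
  have h₂ := frobeniusNorm_mul_le_of_orthonormal hY (Pᵀ * (X - Y) + (X - Y)ᵀ * P)
  have h₃ := frobeniusNorm_transpose_mul_add_le P (X - Y)
  have h₄ : spectralNorm' (Pᵀ * X + Xᵀ * P) ≤ 2 * spectralNorm' P := by
    linarith [spectralNorm'_transpose_mul_add_le P X, mul_le_of_le_one_right
      (spectralNorm'_nonneg P) (spectralNorm'_le_one_of_orthonormal hX)]
  have h₅ := mul_le_mul_of_nonneg_left h₄ (frobeniusNorm_nonneg (X - Y))
  linarith [frobeniusNorm_add_le ((X - Y) * (Pᵀ * X + Xᵀ * P))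
    (Y * (Pᵀ * (X - Y) + (X - Y)ᵀ * P))]

/-- Lemma: Lipschitz-type bound for the Stiefel tangent-space projections. -/
theorem proj_tangent_lipschitz {n r : ℕ}
    (P Pt X Xt : Matrix (Fin n) (Fin r) ℝ)
    (hX : Xᵀ * X = 1) (hXt : Xtᵀ * Xt = 1) :
    frobeniusNorm ((P - (1 / 2 : ℝ) • (X * (Pᵀ * X + Xᵀ * P))) -
        (Pt - (1 / 2 : ℝ) • (Xt * (Ptᵀ * Xt + Xtᵀ * Pt)))) ≤
      2 * frobeniusNorm (P - Pt) +
        2 * Real.sqrt r * spectralNorm' P * frobeniusNorm (X - Xt) := by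
  rcases Nat.eq_zero_or_pos r with rfl | hr
  · simp [frobeniusNorm]
  have h_split : (P - (1 / 2 : ℝ) • (X * (Pᵀ * X + Xᵀ * P))) -
      (Pt - (1 / 2 : ℝ) • (Xt * (Ptᵀ * Xt + Xtᵀ * Pt))) =
      ((P - Pt) - (1 / 2 : ℝ) • (Xt * ((P - Pt)ᵀ * Xt + Xtᵀ * (P - Pt)))) -
        (1 / 2 : ℝ) • (X * (Pᵀ * X + Xᵀ * P) - Xt * (Pᵀ * Xt + Xtᵀ * P)) := by
    simp only [transpose_sub, Matrix.mul_add, Matrix.mul_sub, Matrix.sub_mul, smul_add, smul_sub]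
    abel
  rw [h_split]
  refine (frobeniusNorm_sub_le _ _).trans (add_le_add (frobeniusNorm_proj_le (P - Pt) hXt) ?_)
  rw [frobeniusNorm_smul, abs_of_nonneg (by norm_num)]
  have h_sqrt : 1 ≤ Real.sqrt r := Real.one_le_sqrt.2 (by exact_mod_cast hr)
  have h_nonneg := mul_nonneg (spectralNorm'_nonneg P) (frobeniusNorm_nonneg (X - Xt))
  linarith [frobeniusNorm_mul_sym_sub_le P hX hXt, le_mul_of_one_le_left h_nonneg h_sqrt]
end

section
/- For every p ∈ (0, 1), one has (p − 3)·2^p + (p + 3) ≤ 0. -/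
/-- Lemma: (p − 3)·2^p + (p + 3) ≤ 0 for all p ∈ (0, 1). -/
theorem p_three_two_pow (p : ℝ) (hp : p ∈ Set.Ioo (0 : ℝ) 1) :
    (p - 3) * (2 : ℝ) ^ p + (p + 3) ≤ 0 := by
  obtain ⟨hp0, hp1⟩ := hp
  have hseries_p := Real.hasSum_log_sub_log_of_abs_lt_one (x := p / 3)
    (by rw [abs_of_pos (by positivity)]; linarith)
  have hseries_one := (Real.hasSum_log_sub_log_of_abs_lt_one (x := 1 / 3)
    (by rw [abs_of_pos (by positivity)]; norm_num)).mul_left p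
  have hlog : Real.log (1 + p / 3) - Real.log (1 - p / 3) ≤
      p * (Real.log (1 + 1 / 3) - Real.log (1 - 1 / 3)) := by
    refine hasSum_le (fun k => ?_) hseries_p hseries_one
    have hpow : p ^ (2 * k + 1) ≤ p := pow_le_of_le_one hp0.le hp1.le (by omega)
    calc 2 * (1 / (2 * (k : ℝ) + 1)) * (p / 3) ^ (2 * k + 1)
        = p ^ (2 * k + 1) * (2 * (1 / (2 * (k : ℝ) + 1)) * (1 / 3) ^ (2 * k + 1)) := by
          rw [div_eq_mul_one_div p 3, mul_pow]; ring
      _ ≤ p * (2 * (1 / (2 * (k : ℝ) + 1)) * (1 / 3) ^ (2 * k + 1)) := by gcongr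
  have hpos : 0 < 1 - p / 3 := by linarith
  rw [← Real.log_div (by positivity) hpos.ne', ← Real.log_div (by norm_num) (by norm_num),
    show (1 + 1 / 3 : ℝ) / (1 - 1 / 3) = 2 by norm_num, ← Real.log_rpow two_pos,
    Real.log_le_log_iff (by positivity) (by positivity), div_le_iff₀ hpos] at hlog
  linarith
end

section
/- Let β_t = β₀·(1 + ξ·t^p) for integers t ≥ 0, where β₀ > 0 and ξ, p ∈ (0, 1). Then for every integer t ≥ 1, ((1/β_{t−1}) − (1/β_t)) / ((1/β_t) − (1/β_{t+1})) ≤ 3/p. -/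
/-- On `[0, 1]`, the function `2 ^ p` dominates the Möbius map through its endpoint values. -/
theorem three_add_le_two_rpow_mul {p : ℝ} (hp₀ : 0 ≤ p) (hp₁ : p ≤ 1) :
    3 + p ≤ (2 : ℝ) ^ p * (3 - p) := by
  have h₁ := Real.hasSum_log_sub_log_of_abs_lt_one (x := p / 3)
    (by rw [abs_lt]; constructor <;> linarith)
  have h₂ := (Real.hasSum_log_sub_log_of_abs_lt_one (x := 1 / 3)
    (by rw [abs_lt]; norm_num)).mul_left p
  have hle := hasSum_le (fun k : ℕ => by
    have hpow : p ^ (2 * k + 1) ≤ p := pow_le_of_le_one hp₀ hp₁ (by omega)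
    have hc : (0 : ℝ) ≤ 2 * (1 / (2 * k + 1)) * (1 / 3) ^ (2 * k + 1) := by positivity
    calc 2 * (1 / (2 * (k : ℝ) + 1)) * (p / 3) ^ (2 * k + 1)
        = p ^ (2 * k + 1) * (2 * (1 / (2 * k + 1)) * (1 / 3) ^ (2 * k + 1)) := by
          rw [div_eq_mul_one_div p 3, mul_pow]; ring
      _ ≤ p * (2 * (1 / (2 * k + 1)) * (1 / 3) ^ (2 * k + 1)) :=
          mul_le_mul_of_nonneg_right hpow hc) h₁ h₂
  rw [← Real.log_div (by linarith) (by linarith), ← Real.log_div (by norm_num) (by norm_num),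
    show (1 + 1 / 3 : ℝ) / (1 - 1 / 3) = 2 by norm_num, ← Real.log_rpow (by norm_num),
    Real.log_le_log_iff (div_pos (by linarith) (by linarith)) (by positivity),
    div_le_iff₀ (by linarith)] at hle
  linarith

/-- Upper bound for the forward increment of `x ↦ x ^ p`, from Bernoulli's inequality. -/
theorem rpow_add_le_of_le_one {p x h : ℝ} (hp₀ : 0 ≤ p) (hp₁ : p ≤ 1) (hx : 0 < x)
    (hxh : 0 ≤ x + h) : (x + h) ^ p ≤ x ^ p * (1 + p * (h / x)) := by
  have hs : -1 ≤ h / x := by rw [le_div_iff₀ hx]; linarith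
  rw [show x + h = x * (1 + h / x) by field_simp, Real.mul_rpow hx.le (by linarith)]
  exact mul_le_mul_of_nonneg_left (rpow_one_add_le_one_add_mul_self hs hp₀ hp₁) (by positivity)

/-- Cross-multiplied comparison of successive increments of `ξ⁻¹ + x ^ p`. -/
theorem increment_comparison {p ξ : ℝ} (hp₀ : 0 < p) (hp₁ : p < 1) (hξ₀ : 0 < ξ) (hξ₁ : ξ < 1)
    (n : ℕ) :
    p * (((n : ℝ) + 1) ^ p - (n : ℝ) ^ p) * (1 + ξ * ((n : ℝ) + 2) ^ p) ≤
      3 * (((n : ℝ) + 2) ^ p - ((n : ℝ) + 1) ^ p) * (1 + ξ * (n : ℝ) ^ p) := by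
  rcases Nat.eq_zero_or_pos n with rfl | hn
  · have h := three_add_le_two_rpow_mul hp₀.le hp₁.le
    have hpos : (0 : ℝ) < p * 2 ^ p := by positivity
    simp only [Nat.cast_zero, zero_add, Real.one_rpow, Real.zero_rpow hp₀.ne']
    nlinarith [mul_pos hpos (sub_pos.2 hξ₁)]
  · have hn : (1 : ℝ) ≤ n := by exact_mod_cast hn
    generalize (n : ℝ) = x at hn ⊢
    have h₁ := rpow_add_le_of_le_one (h := 1) hp₀.le hp₁.le (show 0 < x by linarith) (by linarith)
    have h₂ := rpow_add_le_of_le_one (x := x + 2) (h := -1) hp₀.le hp₁.le (by linarith)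
      (by linarith)
    rw [show x + 2 + -1 = x + 1 by ring] at h₂
    have hmono : x ^ p ≤ (x + 2) ^ p := Real.rpow_le_rpow (by linarith) (by linarith) hp₀.le
    have ha : 0 < x ^ p := Real.rpow_pos_of_pos (by linarith) p
    have hc : 0 < (x + 2) ^ p := Real.rpow_pos_of_pos (by linarith) p
    have hinv : 1 / x ≤ 3 * (1 / (x + 2)) := by
      rw [mul_one_div, div_le_div_iff₀ (by linarith) (by linarith)]; linarith
    generalize (x + 2) ^ p = c at *
    generalize (x + 1) ^ p = b at *
    generalize x ^ p = a at *
    have hx : 0 < x := by linarith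
    calc p * (b - a) * (1 + ξ * c) ≤ p * (a * (p * (1 / x))) * (1 + ξ * c) := by
          gcongr; linarith
      _ = p * (p * (1 / x)) * (a * (1 + ξ * c)) := by ring
      _ ≤ 1 * (p * (3 * (1 / (x + 2)))) * (c * (1 + ξ * a)) := by
          gcongr ?_ * (_ * ?_) * ?_
          linarith
      _ = 3 * (c * (p * (1 / (x + 2)))) * (1 + ξ * a) := by ring
      _ ≤ 3 * (c - b) * (1 + ξ * a) := by
          gcongr
          rw [neg_div] at h₂
          linarith


/-- Lemma: ratio bound for successive differences of the reciprocals of the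
penalty sequence β_t = β₀ (1 + ξ t^p). -/
theorem penalty_reciprocal_ratio_bound (β : ℕ → ℝ) (β₀ ξ p : ℝ) (hβ₀ : 0 < β₀)
    (hξ : ξ ∈ Set.Ioo (0 : ℝ) 1) (hp : p ∈ Set.Ioo (0 : ℝ) 1)
    (hβ : ∀ t : ℕ, β t = β₀ * (1 + ξ * (t : ℝ) ^ p)) :
    ∀ t : ℕ, 1 ≤ t →
      ((β (t - 1))⁻¹ - (β t)⁻¹) / ((β t)⁻¹ - (β (t + 1))⁻¹) ≤ 3 / p := by
  obtain ⟨hξ₀, hξ₁⟩ := hξ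
  obtain ⟨hp₀, hp₁⟩ := hp
  intro t ht
  obtain ⟨n, rfl⟩ := Nat.exists_eq_add_of_le' ht
  have key := increment_comparison hp₀ hp₁ hξ₀ hξ₁ n
  have hbc : ((n : ℝ) + 1) ^ p < ((n : ℝ) + 2) ^ p :=
    Real.rpow_lt_rpow (by positivity) (by linarith) hp₀
  have ha : 0 ≤ (n : ℝ) ^ p := by positivity
  have hb : 0 ≤ ((n : ℝ) + 1) ^ p := by positivity
  rw [Nat.add_sub_cancel, hβ, hβ, hβ]
  push_cast
  rw [show (n : ℝ) + 1 + 1 = n + 2 by ring]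
  generalize ((n : ℝ) + 2) ^ p = c at *
  generalize ((n : ℝ) + 1) ^ p = b at *
  generalize (n : ℝ) ^ p = a at *
  have hA : 0 < 1 + ξ * a := by positivity
  have hB : 0 < 1 + ξ * b := by positivity
  have hc : 0 < c := by linarith
  have hC : 0 < 1 + ξ * c := by positivity
  have hcb : 0 < c - b := sub_pos.2 hbc
  have heq : ((β₀ * (1 + ξ * a))⁻¹ - (β₀ * (1 + ξ * b))⁻¹) /
      ((β₀ * (1 + ξ * b))⁻¹ - (β₀ * (1 + ξ * c))⁻¹) =
      ((b - a) * (1 + ξ * c)) / ((c - b) * (1 + ξ * a)) := by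
    have h₁ : (β₀ * (1 + ξ * a))⁻¹ - (β₀ * (1 + ξ * b))⁻¹ =
        ξ * (b - a) / (β₀ * (1 + ξ * a) * (1 + ξ * b)) := by
      field_simp; ring
    have h₂ : (β₀ * (1 + ξ * b))⁻¹ - (β₀ * (1 + ξ * c))⁻¹ =
        ξ * (c - b) / (β₀ * (1 + ξ * b) * (1 + ξ * c)) := by
      field_simp; ring
    rw [h₁, h₂]
    field_simp
  rw [heq, div_le_div_iff₀ (by positivity) hp₀]
  linarith
end

section
/- Let β_t = β₀·(1 + ξ·t^p) for integers t ≥ 0, where β₀ > 0 and ξ, p ∈ (0, 1). Then for every integer t ≥ 1, (β_t/β_{t−1} − 1)² ≤ ((1/β_t) − (1/β_{t+1}))·(6·β₀/p). -/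
/-- Bernoulli's inequality for concave real powers, centred at an arbitrary positive base point. -/
lemma rpow_add_le_rpow_mul {x h p : ℝ} (hx : 0 < x) (hh : -x ≤ h) (hp₀ : 0 ≤ p) (hp₁ : p ≤ 1) :
    (x + h) ^ p ≤ x ^ p * (1 + p * (h / x)) := by
  have hs : -1 ≤ h / x := by rw [le_div_iff₀ hx]; linarith
  have hxh : x + h = x * (1 + h / x) := by field_simp
  rw [hxh, Real.mul_rpow hx.le (by linarith)]
  exact mul_le_mul_of_nonneg_left (rpow_one_add_le_one_add_mul_self hs hp₀ hp₁)
    (Real.rpow_nonneg hx.le p)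

/-- On `[0, v]` the convex function `u ↦ log (1 + u) - log (1 - u)` lies below its chord. -/
lemma log_one_add_sub_log_one_sub_le_chord {u v : ℝ} (hu : 0 ≤ u) (huv : u ≤ v) (hv : v < 1) :
    v * (Real.log (1 + u) - Real.log (1 - u)) ≤ u * (Real.log (1 + v) - Real.log (1 - v)) := by
  have h₁ := (Real.hasSum_log_sub_log_of_abs_lt_one
    (abs_lt.2 ⟨by linarith, huv.trans_lt hv⟩)).mul_left v
  have h₂ := (Real.hasSum_log_sub_log_of_abs_lt_one
    (abs_lt.2 ⟨by linarith, hv⟩)).mul_left u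
  refine hasSum_le (fun k => ?_) h₁ h₂
  have hpow : u ^ (2 * k) ≤ v ^ (2 * k) := pow_le_pow_left₀ hu huv _
  have hc : 0 ≤ 2 * (1 / (2 * (k : ℝ) + 1)) * (u * v) := by
    have := hu.trans huv
    positivity
  calc v * (2 * (1 / (2 * (k : ℝ) + 1)) * u ^ (2 * k + 1))
      = 2 * (1 / (2 * (k : ℝ) + 1)) * (u * v) * u ^ (2 * k) := by ring
    _ ≤ 2 * (1 / (2 * (k : ℝ) + 1)) * (u * v) * v ^ (2 * k) :=
        mul_le_mul_of_nonneg_left hpow hc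
    _ = u * (2 * (1 / (2 * (k : ℝ) + 1)) * v ^ (2 * k + 1)) := by ring

lemma mul_one_add_two_rpow_le {p : ℝ} (hp₀ : 0 ≤ p) (hp₁ : p ≤ 1) :
    p * (1 + (2 : ℝ) ^ p) ≤ 3 * ((2 : ℝ) ^ p - 1) := by
  have hx₁ : 1 ≤ (2 : ℝ) ^ p := Real.one_le_rpow (by norm_num) hp₀
  have hx₂ : (2 : ℝ) ^ p ≤ 2 := by
    simpa using Real.rpow_le_rpow_of_exponent_le (by norm_num : (1 : ℝ) ≤ 2) hp₁
  have hlog : Real.log ((2 : ℝ) ^ p) = p * Real.log 2 := Real.log_rpow (by norm_num) p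
  set x := (2 : ℝ) ^ p
  have hx : 0 < x + 1 := by linarith
  have h := log_one_add_sub_log_one_sub_le_chord (u := (x - 1) / (x + 1)) (v := 1 / 3)
    (div_nonneg (by linarith) hx.le) (by rw [div_le_iff₀ hx]; linarith) (by norm_num)
  have e₁ : 1 + (x - 1) / (x + 1) = 2 * x / (x + 1) := by field_simp; ring
  have e₂ : 1 - (x - 1) / (x + 1) = 2 / (x + 1) := by field_simp; ring
  have e₃ : 2 * x / (x + 1) / (2 / (x + 1)) = x := by field_simp
  have e₄ : (1 + 1 / 3 : ℝ) / (1 - 1 / 3) = 2 := by norm_num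
  rw [e₁, e₂, ← Real.log_div (by positivity) (by positivity), e₃,
    ← Real.log_div (by norm_num) (by norm_num), e₄, hlog, ← mul_assoc] at h
  have h' := le_of_mul_le_mul_right h (Real.log_pos one_lt_two)
  rw [le_div_iff₀ hx] at h'
  linarith

/-- The squared backward difference of `y ↦ y ^ p` is controlled by the next forward difference. -/
lemma mul_sq_rpow_sub_le {s p : ℝ} (hs : 1 ≤ s) (hp₀ : 0 ≤ p) (hp₁ : p ≤ 1) :
    p * ((s + 1) ^ p - s ^ p) ^ 2 ≤ (s + 2) ^ p - (s + 1) ^ p := by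
  have hs₀ : 0 < s := by linarith
  have hs₂ : 0 < s + 2 := by linarith
  have hb := rpow_add_le_rpow_mul hs₀ (by linarith : -s ≤ 1) hp₀ hp₁
  have hbc := rpow_add_le_rpow_mul hs₂ (by linarith : -(s + 2) ≤ -1) hp₀ hp₁
  have hac := rpow_add_le_rpow_mul hs₂ (by linarith : -(s + 2) ≤ -2) hp₀ hp₁
  have ha := rpow_add_le_rpow_mul one_pos (by linarith : -1 ≤ s - 1) hp₀ hp₁
  have hab : s ^ p ≤ (s + 1) ^ p := Real.rpow_le_rpow hs₀.le (by linarith) hp₀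
  rw [show s + 2 + -1 = s + 1 by ring] at hbc
  rw [show s + 2 + -2 = s by ring] at hac
  rw [show 1 + (s - 1) = s by ring, Real.one_rpow, one_mul, div_one] at ha
  have ha₀ : 0 < s ^ p := Real.rpow_pos_of_pos hs₀ p
  have hc₀ : 0 < (s + 2) ^ p := Real.rpow_pos_of_pos hs₂ p
  set a := s ^ p
  set b := (s + 1) ^ p
  set c := (s + 2) ^ p
  have hpoly : p ^ 2 * ((1 + p * (s - 1)) * (s + 2 - 2 * p)) ≤ s ^ 2 := by
    have hr : 0 ≤ s - 1 := by linarith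
    have h₀ : p ^ 2 * (3 - 2 * p) ≤ 1 := by nlinarith [sq_nonneg (1 - p)]
    have h₂ : p ^ 2 ≤ 1 := pow_le_one₀ hp₀ hp₁
    have h₃ : p ^ 3 ≤ 1 := pow_le_one₀ hp₀ hp₁
    have h₁ : p ^ 2 + p * (p ^ 2 * (3 - 2 * p)) ≤ 2 := by nlinarith
    nlinarith [mul_le_mul_of_nonneg_right h₁ hr, mul_le_mul_of_nonneg_right h₃ (sq_nonneg (s - 1))]
  have hac' : a * (s + 2) ≤ c * (s + 2 - 2 * p) := by
    calc a * (s + 2) ≤ c * (1 + p * (-2 / (s + 2))) * (s + 2) :=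
          mul_le_mul_of_nonneg_right hac hs₂.le
      _ = c * (s + 2 - 2 * p) := by field_simp; ring
  have hmain : p ^ 2 * a ^ 2 * (s + 2) ≤ c * s ^ 2 := by
    have hq : 0 ≤ s + 2 - 2 * p := by linarith
    calc p ^ 2 * a ^ 2 * (s + 2) = p ^ 2 * (a * (a * (s + 2))) := by ring
      _ ≤ p ^ 2 * ((1 + p * (s - 1)) * (c * (s + 2 - 2 * p))) := by gcongr
      _ = c * (p ^ 2 * ((1 + p * (s - 1)) * (s + 2 - 2 * p))) := by ring
      _ ≤ c * s ^ 2 := by gcongr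
  have hba : b - a ≤ p * a / s := by
    calc b - a ≤ a * (1 + p * (1 / s)) - a := by linarith
      _ = p * a / s := by field_simp; ring
  calc p * (b - a) ^ 2 ≤ p * (p * a / s) ^ 2 := by
        have : 0 ≤ b - a := by linarith
        gcongr
    _ = p * (p ^ 2 * a ^ 2 / s ^ 2) := by rw [div_pow, mul_pow]
    _ ≤ p * (c / (s + 2)) := by
        refine mul_le_mul_of_nonneg_left ?_ hp₀
        rw [div_le_div_iff₀ (by positivity) hs₂]
        exact hmain
    _ = c - c * (1 + p * (-1 / (s + 2))) := by ring
    _ ≤ c - b := by linarith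

lemma rpow_growth_polynomial_bound {s ξ p : ℝ} (hs : s = 0 ∨ 1 ≤ s) (hξ₀ : 0 ≤ ξ) (hξ₁ : ξ ≤ 1)
    (hp₀ : 0 < p) (hp₁ : p ≤ 1) :
    ξ * p * ((s + 1) ^ p - s ^ p) ^ 2 * ((1 + ξ * (s + 1) ^ p) * (1 + ξ * (s + 2) ^ p)) ≤
      6 * ((s + 2) ^ p - (s + 1) ^ p) * (1 + ξ * s ^ p) ^ 2 := by
  rcases hs with rfl | hs
  · have h := mul_one_add_two_rpow_le hp₀.le hp₁
    have hx : 0 < (2 : ℝ) ^ p := by positivity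
    simp only [zero_add, Real.one_rpow, Real.zero_rpow hp₀.ne']
    calc ξ * p * (1 - 0) ^ 2 * ((1 + ξ * 1) * (1 + ξ * (2 : ℝ) ^ p))
        ≤ 1 * p * (1 - 0) ^ 2 * ((1 + 1 * 1) * (1 + 1 * (2 : ℝ) ^ p)) := by gcongr
      _ ≤ 6 * ((2 : ℝ) ^ p - 1) * (1 + ξ * 0) ^ 2 := by linarith
  · have hs₀ : 0 < s := by linarith
    have hd := mul_sq_rpow_sub_le hs hp₀.le hp₁
    have hb := rpow_add_le_rpow_mul hs₀ (by linarith : -s ≤ 1) hp₀.le hp₁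
    have hc := rpow_add_le_rpow_mul hs₀ (by linarith : -s ≤ 2) hp₀.le hp₁
    have ha₀ : 0 < s ^ p := Real.rpow_pos_of_pos hs₀ p
    have hb₀ : 0 < (s + 1) ^ p := Real.rpow_pos_of_pos (by linarith) p
    have hc₀ : 0 < (s + 2) ^ p := Real.rpow_pos_of_pos (by linarith) p
    have hps : p / s ≤ 1 := by rw [div_le_one hs₀]; linarith
    set a := s ^ p
    set b := (s + 1) ^ p
    set c := (s + 2) ^ p
    have hb' : b ≤ 2 * a := by
      calc b ≤ a * (1 + p / s) := by rw [mul_one_div] at hb; exact hb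
        _ ≤ 2 * a := by nlinarith
    have hc' : c ≤ 3 * a := by
      calc c ≤ a * (1 + 2 * (p / s)) := hc.trans_eq (by ring)
        _ ≤ 3 * a := by nlinarith
    have hd₀ : 0 ≤ c - b := le_trans (by positivity) hd
    calc ξ * p * (b - a) ^ 2 * ((1 + ξ * b) * (1 + ξ * c))
        = ξ * (p * (b - a) ^ 2) * ((1 + ξ * b) * (1 + ξ * c)) := by ring
      _ ≤ 1 * (c - b) * ((1 + ξ * (2 * a)) * (1 + ξ * (3 * a))) := by gcongr
      _ ≤ 1 * (c - b) * (6 * (1 + ξ * a) ^ 2) := by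
          refine mul_le_mul_of_nonneg_left ?_ (by linarith)
          nlinarith [mul_nonneg hξ₀ ha₀.le]
      _ = 6 * (c - b) * (1 + ξ * a) ^ 2 := by ring

/-- Lemma: squared relative growth of the penalty sequence β_t = β₀ (1 + ξ t^p)
is controlled by the difference of reciprocals. -/
theorem penalty_relative_growth_bound (β : ℕ → ℝ) (β₀ ξ p : ℝ) (hβ₀ : 0 < β₀)
    (hξ : ξ ∈ Set.Ioo (0 : ℝ) 1) (hp : p ∈ Set.Ioo (0 : ℝ) 1)
    (hβ : ∀ t : ℕ, β t = β₀ * (1 + ξ * (t : ℝ) ^ p)) :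
    ∀ t : ℕ, 1 ≤ t →
      (β t / β (t - 1) - 1) ^ 2 ≤ ((β t)⁻¹ - (β (t + 1))⁻¹) * (6 * β₀ / p) := by
  obtain ⟨hξ₀, hξ₁⟩ := hξ
  obtain ⟨hp₀, hp₁⟩ := hp
  intro t ht
  obtain ⟨n, rfl⟩ := Nat.exists_eq_add_of_le' ht
  have hn : (n : ℝ) = 0 ∨ 1 ≤ (n : ℝ) := by
    rcases Nat.eq_zero_or_pos n with h | h
    · exact Or.inl (by exact_mod_cast h)
    · exact Or.inr (by exact_mod_cast h)
  have h := rpow_growth_polynomial_bound hn hξ₀.le hξ₁.le hp₀ hp₁.le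
  have hn₁ : ((n + 1 : ℕ) : ℝ) = n + 1 := by push_cast; ring
  have hn₂ : ((n + 1 + 1 : ℕ) : ℝ) = n + 2 := by push_cast; ring
  rw [Nat.add_sub_cancel, hβ, hβ, hβ, hn₁, hn₂]
  have ha : 0 ≤ (n : ℝ) ^ p := by positivity
  have hb : 0 ≤ ((n : ℝ) + 1) ^ p := by positivity
  have hc : 0 ≤ ((n : ℝ) + 2) ^ p := by positivity
  set a := (n : ℝ) ^ p
  set b := ((n : ℝ) + 1) ^ p
  set c := ((n : ℝ) + 2) ^ p
  have hA : 0 < 1 + ξ * a := by positivity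
  have hB : 0 < 1 + ξ * b := by positivity
  have hC : 0 < 1 + ξ * c := by positivity
  have hl : (β₀ * (1 + ξ * b) / (β₀ * (1 + ξ * a)) - 1) ^ 2 =
      ξ ^ 2 * (b - a) ^ 2 / (1 + ξ * a) ^ 2 := by
    field_simp
    ring
  have hr : ((β₀ * (1 + ξ * b))⁻¹ - (β₀ * (1 + ξ * c))⁻¹) * (6 * β₀ / p) =
      6 * ξ * (c - b) / (p * ((1 + ξ * b) * (1 + ξ * c))) := by
    field_simp
    ring
  rw [hl, hr, div_le_div_iff₀ (by positivity) (by positivity)]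
  linarith [mul_le_mul_of_nonneg_left h hξ₀.le]
end

section
/- Let β_t = β₀·(1 + ξ·t^p) for integers t ≥ 0, where β₀ > 0, ξ > 0, and p ∈ [1/4, 1). Then for every integer t ≥ 1, (1/β_t)³ ≤ (2/(ξ·β₀)²)·√(((1/β_{t−1}) − (1/β_t))·(1/β_{t−1})). -/
/-- Concavity of `x ↦ x ^ p`: the backward difference dominates the derivative. -/
theorem mul_rpow_sub_one_le_rpow_sub_rpow {p x : ℝ} (hp₀ : 0 ≤ p) (hp₁ : p ≤ 1) (hx : 1 ≤ x) :
    p * x ^ (p - 1) ≤ x ^ p - (x - 1) ^ p := by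
  have hx₀ : 0 < x := by linarith
  have hinv : x⁻¹ ≤ 1 := inv_le_one_of_one_le₀ hx
  have hbern : (1 + -x⁻¹) ^ p ≤ 1 + p * -x⁻¹ :=
    rpow_one_add_le_one_add_mul_self (by linarith) hp₀ hp₁
  have hfactor : (x - 1) ^ p = x ^ p * (1 + -x⁻¹) ^ p := by
    rw [← Real.mul_rpow hx₀.le (by linarith)]
    congr 1
    field_simp
    ring
  have hmul := mul_le_mul_of_nonneg_left hbern (Real.rpow_nonneg hx₀.le p)
  rw [hfactor, Real.rpow_sub_one hx₀.ne', div_eq_mul_inv]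
  linarith

theorem one_le_four_mul_rpow_cube_mul_rpow_sub_one {p x : ℝ} (hp : 1 / 4 ≤ p) (hx : 1 ≤ x) :
    1 ≤ 4 * (x ^ p) ^ 3 * (p * x ^ (p - 1)) := by
  have hx₀ : 0 < x := by linarith
  have hpow : (x ^ p) ^ 3 * x ^ (p - 1) = x ^ (4 * p - 1) := by
    rw [← Real.rpow_natCast, ← Real.rpow_mul hx₀.le, ← Real.rpow_add hx₀]
    congr 1
    push_cast
    ring
  have hone : 1 ≤ x ^ (4 * p - 1) := Real.one_le_rpow hx (by linarith)
  calc (1 : ℝ) ≤ 4 * p * x ^ (4 * p - 1) := by nlinarith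
    _ = 4 * (x ^ p) ^ 3 * (p * x ^ (p - 1)) := by rw [← hpow]; ring

theorem pow_four_mul_sq_le_of_one_le {ξ x y : ℝ} (hξ : 0 < ξ) (hx : 0 ≤ x) (hxy : x ≤ y)
    (h : 1 ≤ 4 * y ^ 3 * (y - x)) :
    ξ ^ 4 * (1 + ξ * x) ^ 2 ≤ 4 * (1 + ξ * y) ^ 5 * (ξ * (y - x)) := by
  have hy : 0 ≤ y := hx.trans hxy
  have hd : 0 ≤ y - x := sub_nonneg.2 hxy
  calc ξ ^ 4 * (1 + ξ * x) ^ 2 ≤ ξ ^ 4 * (1 + ξ * y) ^ 2 := by gcongr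
    _ ≤ ξ ^ 4 * (1 + ξ * y) ^ 2 * (4 * y ^ 3 * (y - x)) :=
      le_mul_of_one_le_right (by positivity) h
    _ = 4 * ((ξ * y) ^ 3 * (1 + ξ * y) ^ 2) * (ξ * (y - x)) := by ring
    _ ≤ 4 * ((1 + ξ * y) ^ 3 * (1 + ξ * y) ^ 2) * (ξ * (y - x)) := by
      gcongr
      linarith
    _ = 4 * (1 + ξ * y) ^ 5 * (ξ * (y - x)) := by ring

theorem inv_cube_le_mul_sqrt {c ξ a b : ℝ} (hc : 0 < c) (hξ : 0 < ξ) (ha : 0 < a) (hb : 0 < b)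
    (h : ξ ^ 4 * a ^ 2 ≤ 4 * b ^ 5 * (b - a)) :
    ((c * b)⁻¹) ^ 3 ≤
      (2 / (ξ * c) ^ 2) * Real.sqrt (((c * a)⁻¹ - (c * b)⁻¹) * (c * a)⁻¹) := by
  have hsqrt : (ξ * c) ^ 2 / 2 * ((c * b)⁻¹) ^ 3 ≤
      Real.sqrt (((c * a)⁻¹ - (c * b)⁻¹) * (c * a)⁻¹) := by
    apply Real.le_sqrt_of_sq_le
    have hl : ((ξ * c) ^ 2 / 2 * ((c * b)⁻¹) ^ 3) ^ 2 =
        ξ ^ 4 * a ^ 2 / (4 * c ^ 2 * a ^ 2 * b ^ 6) := by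
      field_simp
      ring
    have hr : ((c * a)⁻¹ - (c * b)⁻¹) * (c * a)⁻¹ =
        4 * b ^ 5 * (b - a) / (4 * c ^ 2 * a ^ 2 * b ^ 6) := by
      field_simp
    rw [hl, hr]
    gcongr
  calc ((c * b)⁻¹) ^ 3 = (2 / (ξ * c) ^ 2) * ((ξ * c) ^ 2 / 2 * ((c * b)⁻¹) ^ 3) := by
        field_simp
    _ ≤ _ := by gcongr

/-- Lemma: cube of the reciprocal penalty is controlled by the square root of the
product of the reciprocal difference with the previous reciprocal. -/
theorem penalty_reciprocal_cube_bound (β : ℕ → ℝ) (β₀ ξ p : ℝ) (hβ₀ : 0 < β₀)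
    (hξ : 0 < ξ) (hp : p ∈ Set.Ico (1 / 4 : ℝ) 1)
    (hβ : ∀ t : ℕ, β t = β₀ * (1 + ξ * (t : ℝ) ^ p)) :
    ∀ t : ℕ, 1 ≤ t →
      ((β t)⁻¹) ^ 3 ≤
        (2 / (ξ * β₀) ^ 2) * Real.sqrt (((β (t - 1))⁻¹ - (β t)⁻¹) * (β (t - 1))⁻¹) := by
  intro t ht
  obtain ⟨hp₀, hp₁⟩ := hp
  have ht' : (1 : ℝ) ≤ t := by exact_mod_cast ht
  have hdiff := mul_rpow_sub_one_le_rpow_sub_rpow (by linarith : 0 ≤ p) hp₁.le ht'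
  have hone := one_le_four_mul_rpow_cube_mul_rpow_sub_one hp₀ ht'
  have hx : 0 ≤ ((t : ℝ) - 1) ^ p := Real.rpow_nonneg (by linarith) p
  have hxy : ((t : ℝ) - 1) ^ p ≤ (t : ℝ) ^ p :=
    Real.rpow_le_rpow (by linarith) (by linarith) (by linarith)
  have hkey : 1 ≤ 4 * ((t : ℝ) ^ p) ^ 3 * ((t : ℝ) ^ p - ((t : ℝ) - 1) ^ p) :=
    hone.trans (by gcongr)
  rw [hβ, hβ, Nat.cast_sub ht, Nat.cast_one]
  refine inv_cube_le_mul_sqrt hβ₀ hξ (by positivity) (by positivity) ?_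
  convert pow_four_mul_sq_le_of_one_le hξ hx hxy hkey using 2
  ring
end

section
/- Let (e_t)_{t≥0} and (p_t)_{t≥0} be sequences of nonnegative real numbers such that p_t ≥ p_{t+1} for all t, and (e_{t+1})² ≤ e_t·(p_t − p_{t+1}) for all t ≥ 1. Then for every integer i ≥ 1 and every integer T ≥ i, Σ_{t=i}^{T} e_{t+1} ≤ e_i + e_{i−1} + 4·p_i. -/
/-- A telescoping bound, sharper than the finite-length property. -/
theorem sum_add_le_of_sq_le_mul_sub (e p : ℕ → ℝ) (he : ∀ t, 0 ≤ e t)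
    (hmono : ∀ t : ℕ, p (t + 1) ≤ p t) {i : ℕ}
    (hrec : ∀ t : ℕ, i ≤ t → e (t + 1) ^ 2 ≤ e t * (p t - p (t + 1))) {T : ℕ} (hT : i ≤ T) :
    ∑ t ∈ Finset.Icc i T, e (t + 1) + e (T + 1) + p (T + 1) ≤ e i + p i := by
  have step (t : ℕ) (ht : i ≤ t) : 2 * e (t + 1) ≤ e t + (p t - p (t + 1)) :=
    two_mul_le_add_of_sq_le_mul (he t) (sub_nonneg.2 (hmono t)) (hrec t ht)
  induction T, hT using Nat.le_induction with
  | base =>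
    rw [Finset.Icc_self, Finset.sum_singleton]
    linarith [step i le_rfl]
  | succ T hT ih =>
    rw [Finset.sum_Icc_succ_top (by omega)]
    linarith [step (T + 1) (by omega)]

/-- Lemma: finite-length property for a sequence controlled by a KL-type recursion. -/
theorem finite_length_property (e p : ℕ → ℝ) (he : ∀ t, 0 ≤ e t) (hp : ∀ t, 0 ≤ p t)
    (hmono : ∀ t : ℕ, p (t + 1) ≤ p t)
    (hrec : ∀ t : ℕ, 1 ≤ t → e (t + 1) ^ 2 ≤ e t * (p t - p (t + 1))) :
    ∀ i : ℕ, 1 ≤ i → ∀ T : ℕ, i ≤ T →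
      ∑ t ∈ Finset.Icc i T, e (t + 1) ≤ e i + e (i - 1) + 4 * p i := by
  intro i hi T hT
  have := sum_add_le_of_sq_le_mul_sub e p he hmono (fun t ht => hrec t (hi.trans ht)) hT
  linarith [he (T + 1), hp (T + 1), he (i - 1), hp i]
end

section
/- Let (d_t)_{t≥0} be a nonincreasing sequence of nonnegative real numbers satisfying, for every integer t ≥ 1, d_t ≤ (d_{t−1} − d_t) + c·t^{p·u}·(d_{t−1} − d_t)^u, where c > 0, u > 0, and p ∈ (0, 1). Then there exists a constant C > 0 such that d_t ≤ C·t^{−(1−p)·u} for every integer t ≥ 1. -/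
/-- Among `m` consecutive decrements of a nonnegative sequence starting at index `m`, one is at most
the average `d m / m`. -/
theorem exists_decrement_le_div (d : ℕ → ℝ) (hd : ∀ t, 0 ≤ d t) {m : ℕ} (hm : 1 ≤ m) :
    ∃ i < m, d (m + i) - d (m + i + 1) ≤ d m / m := by
  have hm0 : (0 : ℝ) < m := by exact_mod_cast hm
  have hsum : ∑ i ∈ Finset.range m, (d (m + i) - d (m + i + 1)) ≤
      ∑ _i ∈ Finset.range m, d m / m := by
    have htel := Finset.sum_range_sub' (fun i => d (m + i)) m
    simp only [← add_assoc, add_zero] at htel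
    rw [htel, Finset.sum_const, Finset.card_range, nsmul_eq_mul, mul_div_cancel₀ _ hm0.ne']
    linarith [hd (m + m)]
  obtain ⟨i, hi, h⟩ := Finset.exists_le_of_sum_le (Finset.nonempty_range_iff.2 (by omega)) hsum
  exact ⟨i, Finset.mem_range.1 hi, h⟩

/-- A polynomial decay rate `a` improves to any rate `b ≤ min (a + 1) ((1 - p) * u)`. -/
theorem kl_polynomial_rate_improve (d : ℕ → ℝ) (hd : ∀ t, 0 ≤ d t) (hanti : Antitone d)
    {c u p a b C : ℝ} (hc : 0 < c) (hu : 0 < u) (hp : 0 ≤ p)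
    (hrec : ∀ t : ℕ, 1 ≤ t →
      d t ≤ (d (t - 1) - d t) + c * (t : ℝ) ^ (p * u) * (d (t - 1) - d t) ^ u)
    (ha : 0 ≤ a) (hab : b ≤ a + 1) (hb : b ≤ (1 - p) * u) (hC : 0 < C)
    (hrate : ∀ t : ℕ, 1 ≤ t → d t ≤ C * (t : ℝ) ^ (-a)) :
    ∃ C' > (0 : ℝ), ∀ t : ℕ, 1 ≤ t → d t ≤ C' * (t : ℝ) ^ (-b) := by
  set K : ℝ := C * 3 ^ (a + 1) with hK
  have hK0 : 0 < K := by positivity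
  have hKu : 0 < c * K ^ u := by positivity
  refine ⟨d 1 + (K + c * K ^ u), by linarith [hd 1], fun T hT => ?_⟩
  obtain rfl | hT2 : T = 1 ∨ 2 ≤ T := by omega
  · simp only [Nat.cast_one, Real.one_rpow, mul_one]
    linarith
  have hT1 : (1 : ℝ) ≤ T := by exact_mod_cast hT
  have hT0 : (0 : ℝ) < T := by linarith
  obtain ⟨m, hm, hmT, hTm⟩ : ∃ m : ℕ, 1 ≤ m ∧ 2 * m ≤ T ∧ T ≤ 3 * m :=
    ⟨T / 2, by omega, by omega, by omega⟩
  have hm0 : (0 : ℝ) < m := by exact_mod_cast hm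
  have hTm' : (T : ℝ) / 3 ≤ m := by
    have : (T : ℝ) ≤ 3 * m := by exact_mod_cast hTm
    linarith
  obtain ⟨i, hi, hdec⟩ := exists_decrement_le_div d hd hm
  set e : ℝ := d (m + i) - d (m + i + 1) with he
  have he0 : 0 ≤ e := sub_nonneg.2 (hanti (Nat.le_succ _))
  have heK : e ≤ K * (T : ℝ) ^ (-(a + 1)) := calc
    e ≤ d m / m := hdec
    _ ≤ C * (m : ℝ) ^ (-a) / m := by gcongr; exact hrate m hm
    _ = C * (m : ℝ) ^ (-(a + 1)) := by
      rw [neg_add, Real.rpow_add hm0, Real.rpow_neg_one, div_eq_mul_inv, mul_assoc]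
    _ ≤ C * ((T : ℝ) / 3) ^ (-(a + 1)) := by
      gcongr C * ?_
      exact Real.rpow_le_rpow_of_nonpos (by positivity) hTm' (by linarith)
    _ = K * (T : ℝ) ^ (-(a + 1)) := by
      rw [hK, Real.div_rpow hT0.le (by norm_num), Real.rpow_neg (by norm_num : (0 : ℝ) ≤ 3),
        div_inv_eq_mul]
      ring
  have hlin : e ≤ K * (T : ℝ) ^ (-b) := heK.trans (by gcongr)
  have hpow : c * ((m + i + 1 : ℕ) : ℝ) ^ (p * u) * e ^ u ≤ c * K ^ u * (T : ℝ) ^ (-b) := calc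
    _ ≤ c * (T : ℝ) ^ (p * u) * (K * (T : ℝ) ^ (-(a + 1))) ^ u := by
      gcongr
      omega
    _ = c * K ^ u * (T : ℝ) ^ (p * u + -(a + 1) * u) := by
      rw [Real.mul_rpow hK0.le (by positivity), ← Real.rpow_mul hT0.le, Real.rpow_add hT0]
      ring
    _ ≤ c * K ^ u * (T : ℝ) ^ (-b) := by
      gcongr
      nlinarith [mul_nonneg ha hu.le]
  have hstep := hrec (m + i + 1) (by omega)
  rw [Nat.add_sub_cancel, ← he] at hstep
  have hd1 : 0 ≤ d 1 * (T : ℝ) ^ (-b) := mul_nonneg (hd 1) (by positivity)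
  have hdT : d T ≤ d (m + i + 1) := hanti (by omega)
  linarith

/-- Lemma: polynomial convergence rate for a nonincreasing sequence satisfying a
KL-type recursion with exponent u, case ζ = (1 − p)·u. -/
theorem kl_polynomial_rate_case1 (d : ℕ → ℝ) (hd : ∀ t, 0 ≤ d t)
    (hmono : ∀ t : ℕ, d (t + 1) ≤ d t)
    (c u p : ℝ) (hc : 0 < c) (hu : 0 < u) (hp : p ∈ Set.Ioo (0 : ℝ) 1)
    (hrec : ∀ t : ℕ, 1 ≤ t →
      d t ≤ (d (t - 1) - d t) + c * (t : ℝ) ^ (p * u) * (d (t - 1) - d t) ^ u) :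
    ∃ C > (0 : ℝ), ∀ t : ℕ, 1 ≤ t → d t ≤ C * (t : ℝ) ^ (-((1 - p) * u)) := by
  have hanti : Antitone d := antitone_nat_of_succ_le hmono
  have hζ : 0 ≤ (1 - p) * u := mul_nonneg (by linarith [hp.2]) hu.le
  have hiter : ∀ n : ℕ, ∃ C > (0 : ℝ), ∀ t : ℕ, 1 ≤ t →
      d t ≤ C * (t : ℝ) ^ (-min (n : ℝ) ((1 - p) * u)) := by
    intro n
    induction n with
    | zero =>
      refine ⟨d 0 + 1, by linarith [hd 0], fun t _ => ?_⟩
      rw [Nat.cast_zero, min_eq_left hζ, neg_zero, Real.rpow_zero]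
      linarith [hanti (Nat.zero_le t)]
    | succ n ih =>
      obtain ⟨C, hC, hrate⟩ := ih
      refine kl_polynomial_rate_improve d hd hanti hc hu hp.1.le hrec
        (le_min n.cast_nonneg hζ) ?_ (min_le_right _ _) hC hrate
      rw [← min_add_add_right, Nat.cast_succ]
      exact min_le_min le_rfl (by linarith)
  obtain ⟨n, hn⟩ := exists_nat_ge ((1 - p) * u)
  simpa only [min_eq_right hn] using hiter n
end

section
/- Let (d_t)_{t≥0} be a nonincreasing sequence of nonnegative real numbers satisfying, for every integer t ≥ 1, d_t ≤ c·t^{p·u}·(d_{t−1} − d_t)^u, where c > 0, u ∈ (0, 1), and p ∈ (0, 1). Then there exists a constant C > 0 such that d_t ≤ C·t^{−ζ} for every integer t ≥ 1, where ζ = (1 − p)/(1/u − 1). -/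
lemma one_add_pow_le_one_add_mul {x : ℝ} (hx : 0 ≤ x) (hx1 : x ≤ 1) (n : ℕ) :
    (1 + x) ^ n ≤ 1 + (2 ^ n - 1) * x := by
  induction n with
  | zero => simp
  | succ n ih =>
    have h2 : (1 : ℝ) ≤ 2 ^ n := one_le_pow₀ (by norm_num)
    rw [pow_succ, pow_succ]
    nlinarith [mul_le_mul_of_nonneg_right ih (by linarith : 0 ≤ 1 + x),
      mul_nonneg (mul_nonneg (sub_nonneg.2 h2) hx) (sub_nonneg.2 hx1)]

/-- One-step decrease of `t ^ (-z)`, uniformly in `t ≥ 1`. -/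
lemma exists_rpow_neg_sub_le (z : ℝ) :
    ∃ M > (0 : ℝ), ∀ t : ℝ, 1 ≤ t →
      t ^ (-z) - (t + 1) ^ (-z) ≤ M * (t + 1) ^ (-z - 1) := by
  refine ⟨2 * 2 ^ ⌈z⌉₊, by positivity, fun t ht => ?_⟩
  have ht0 : 0 < t := by linarith
  have hs0 : 0 < t + 1 := by linarith
  have hs : 0 < (t + 1) ^ (-z) := Real.rpow_pos_of_pos hs0 _
  have hx : 0 ≤ 1 / t := by positivity
  have hx1 : 1 / t ≤ 1 := (div_le_one ht0).2 ht
  have hratio : t ^ (-z) = (t + 1) ^ (-z) * (1 + 1 / t) ^ z := by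
    rw [show 1 + 1 / t = (t + 1) / t by field_simp, Real.div_rpow hs0.le ht0.le,
      Real.rpow_neg ht0.le, Real.rpow_neg hs0.le]
    have := (Real.rpow_pos_of_pos hs0 z).ne'
    field_simp
  have hpow : (1 + 1 / t) ^ z ≤ 1 + 2 ^ ⌈z⌉₊ * (1 / t) := by
    calc (1 + 1 / t) ^ z ≤ (1 + 1 / t) ^ (⌈z⌉₊ : ℝ) :=
          Real.rpow_le_rpow_of_exponent_le (by linarith) (Nat.le_ceil z)
      _ = (1 + 1 / t) ^ ⌈z⌉₊ := Real.rpow_natCast _ _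
      _ ≤ 1 + (2 ^ ⌈z⌉₊ - 1) * (1 / t) := one_add_pow_le_one_add_mul hx hx1 _
      _ ≤ 1 + 2 ^ ⌈z⌉₊ * (1 / t) := by linarith
  have hinv : 1 / t ≤ 2 / (t + 1) := by
    rw [div_le_div_iff₀ ht0 hs0]
    linarith
  calc t ^ (-z) - (t + 1) ^ (-z) = (t + 1) ^ (-z) * ((1 + 1 / t) ^ z - 1) := by
        rw [hratio]; ring
    _ ≤ (t + 1) ^ (-z) * (2 ^ ⌈z⌉₊ * (2 / (t + 1))) := by
        gcongr
        linarith [mul_le_mul_of_nonneg_left hinv (by positivity : (0 : ℝ) ≤ 2 ^ ⌈z⌉₊)]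
    _ = 2 * 2 ^ ⌈z⌉₊ * (t + 1) ^ (-z - 1) := by
        rw [Real.rpow_sub_one hs0.ne']; ring

/-- Lemma: polynomial convergence rate for a nonincreasing sequence satisfying a
KL-type recursion with exponent u ∈ (0,1), rate ζ = (1 − p)/(1/u − 1). -/
theorem kl_polynomial_rate_case2 (d : ℕ → ℝ) (hd : ∀ t, 0 ≤ d t)
    (hmono : ∀ t : ℕ, d (t + 1) ≤ d t)
    (c u p : ℝ) (hc : 0 < c) (hu : u ∈ Set.Ioo (0 : ℝ) 1) (hp : p ∈ Set.Ioo (0 : ℝ) 1)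
    (hrec : ∀ t : ℕ, 1 ≤ t →
      d t ≤ c * (t : ℝ) ^ (p * u) * (d (t - 1) - d t) ^ u) :
    ∃ C > (0 : ℝ), ∀ t : ℕ, 1 ≤ t →
      d t ≤ C * (t : ℝ) ^ (-((1 - p) / (1 / u - 1))) := by
  obtain ⟨hu0, hu1⟩ := hu
  have hu1' : 0 < 1 - u := by linarith
  have hz : (p + (-((1 - p) / (1 / u - 1)) - 1)) * u = -((1 - p) / (1 / u - 1)) := by
    rw [show 1 / u - 1 = (1 - u) / u by field_simp]
    field_simp
    ring
  generalize (1 - p) / (1 / u - 1) = z at hz ⊢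
  obtain ⟨M, hM, hdecr⟩ := exists_rpow_neg_sub_le z
  have hB : 0 < c * M ^ u := by positivity
  let C := max ((c * M ^ u) ^ (1 / (1 - u))) (d 1)
  have hC : 0 < C := lt_max_of_lt_left (by positivity)
  have hCB : c * M ^ u ≤ C ^ (1 - u) := by
    calc c * M ^ u = ((c * M ^ u) ^ (1 / (1 - u))) ^ (1 - u) := by
          rw [← Real.rpow_mul hB.le, one_div_mul_cancel hu1'.ne', Real.rpow_one]
      _ ≤ C ^ (1 - u) := Real.rpow_le_rpow (by positivity) (le_max_left _ _) hu1'.le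
  refine ⟨C, hC, fun t ht => ?_⟩
  induction t, ht using Nat.le_induction with
  | base =>
    rw [Nat.cast_one, Real.one_rpow, mul_one]
    exact le_max_right _ _
  | succ t ht ih =>
    by_contra! hlt
    have hs0 : (0 : ℝ) < t + 1 := by positivity
    have hr := hrec (t + 1) (by omega)
    push_cast at hr hlt
    have hdiff : d t - d (t + 1) ≤ C * M * ((t : ℝ) + 1) ^ (-z - 1) := by
      have := mul_le_mul_of_nonneg_left (hdecr t (by exact_mod_cast ht)) hC.le
      linarith
    refine hlt.not_ge ?_
    calc d (t + 1) ≤ c * ((t : ℝ) + 1) ^ (p * u) * (d t - d (t + 1)) ^ u := hr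
      _ ≤ c * ((t : ℝ) + 1) ^ (p * u) * (C * M * ((t : ℝ) + 1) ^ (-z - 1)) ^ u := by
          gcongr
          linarith [hmono t]
      _ = (c * M ^ u) * C ^ u * ((t : ℝ) + 1) ^ (-z) := by
          rw [Real.mul_rpow (by positivity) (by positivity), Real.mul_rpow hC.le hM.le,
            ← Real.rpow_mul hs0.le]
          have : ((t : ℝ) + 1) ^ (-z) =
              ((t : ℝ) + 1) ^ (p * u) * ((t : ℝ) + 1) ^ ((-z - 1) * u) := by
            rw [← Real.rpow_add hs0, ← add_mul, hz]
          rw [this]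
          ring
      _ ≤ C ^ (1 - u) * C ^ u * ((t : ℝ) + 1) ^ (-z) := by gcongr
      _ = C * ((t : ℝ) + 1) ^ (-z) := by
          rw [← Real.rpow_add hC, sub_add_cancel, Real.rpow_one]
end

section
/- Let (d_t)_{t≥0} be a sequence of nonnegative real numbers satisfying, for every integer t ≥ 1, d_t ≤ d_{t−1}·(c·t^q)/(c·t^q + 1), where c ≥ 0 and q ∈ (0, 1). Then there exist constants C ≥ 0 and K > 0 such that d_t ≤ C·exp(−K·t^{1−q}) for every integer t ≥ 1. -/
/-- The increments of `t ↦ t ^ (1 - q)` over unit steps ending at `t` are at most `t ^ (-q)`. -/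
theorem rpow_one_sub_increment_le {x q : ℝ} (hx : 0 ≤ x) (hq : 0 ≤ q) (hq1 : q ≤ 1) :
    ((x + 1) ^ (1 - q) - x ^ (1 - q)) * (x + 1) ^ q ≤ 1 := by
  have hsplit : (x + 1) ^ (1 - q) * (x + 1) ^ q = x + 1 := by
    rw [← Real.rpow_add (by positivity), sub_add_cancel, Real.rpow_one]
  have hle : x ≤ x ^ (1 - q) * (x + 1) ^ q := by
    calc x = x ^ ((1 - q) + q) := by rw [sub_add_cancel, Real.rpow_one]
      _ = x ^ (1 - q) * x ^ q := Real.rpow_add_of_nonneg hx (sub_nonneg.2 hq1) hq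
      _ ≤ x ^ (1 - q) * (x + 1) ^ q := by gcongr; linarith
  linarith

theorem div_add_one_le_exp {x : ℝ} (hx : 0 ≤ x) :
    x / (x + 1) ≤ Real.exp (-(1 / (x + 1))) := by
  have h := Real.add_one_le_exp (-(1 / (x + 1)))
  have heq : x / (x + 1) = -(1 / (x + 1)) + 1 := by field_simp; ring
  rwa [heq]

/-- Lemma: super-exponential decay for a nonnegative sequence satisfying a
contraction with vanishing rate. -/
theorem kl_superexponential_rate (d : ℕ → ℝ) (hd : ∀ t, 0 ≤ d t)
    (c q : ℝ) (hc : 0 ≤ c) (hq : q ∈ Set.Ioo (0 : ℝ) 1)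
    (hrec : ∀ t : ℕ, 1 ≤ t →
      d t ≤ d (t - 1) * (c * (t : ℝ) ^ q) / (c * (t : ℝ) ^ q + 1)) :
    ∃ C ≥ (0 : ℝ), ∃ K > (0 : ℝ), ∀ t : ℕ, 1 ≤ t →
      d t ≤ C * Real.exp (-K * (t : ℝ) ^ (1 - q)) := by
  obtain ⟨hq0, hq1⟩ := hq
  refine ⟨d 0, hd 0, 1 / (c + 1), by positivity, fun t _ => ?_⟩
  induction t with
  | zero => simp [Real.zero_rpow (sub_pos.2 hq1).ne']
  | succ n ih =>
    have hn : d n ≤ d 0 * Real.exp (-(1 / (c + 1)) * (n : ℝ) ^ (1 - q)) := by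
      rcases Nat.eq_zero_or_pos n with rfl | hn
      · simp [Real.zero_rpow (sub_pos.2 hq1).ne']
      · exact ih hn
    have hstep := hrec (n + 1) (by omega)
    rw [Nat.add_sub_cancel, mul_div_assoc] at hstep
    push_cast at hstep ⊢
    have hincr := rpow_one_sub_increment_le (Nat.cast_nonneg (α := ℝ) n) hq0.le hq1.le
    have hone : (1 : ℝ) ≤ ((n : ℝ) + 1) ^ q := Real.one_le_rpow (by simp) hq0.le
    set y : ℝ := ((n : ℝ) + 1) ^ q
    set a : ℝ := ((n : ℝ) + 1) ^ (1 - q)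
    set b : ℝ := (n : ℝ) ^ (1 - q)
    have hexp : 1 / (c + 1) * (a - b) ≤ 1 / (c * y + 1) := by
      calc 1 / (c + 1) * (a - b) ≤ 1 / (c + 1) * (1 / y) := by
            gcongr
            rwa [le_div_iff₀ (by positivity)]
        _ = 1 / (c * y + y) := by rw [one_div_mul_one_div, add_mul, one_mul]
        _ ≤ 1 / (c * y + 1) := by gcongr
    calc d (n + 1) ≤ d n * (c * y / (c * y + 1)) := hstep
      _ ≤ (d 0 * Real.exp (-(1 / (c + 1)) * b)) * Real.exp (-(1 / (c * y + 1))) := by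
          gcongr
          · exact mul_nonneg (hd 0) (Real.exp_pos _).le
          · exact div_add_one_le_exp (by positivity)
      _ = d 0 * Real.exp (-(1 / (c + 1)) * b - 1 / (c * y + 1)) := by
          rw [mul_assoc, ← Real.exp_add, sub_eq_add_neg]
      _ ≤ d 0 * Real.exp (-(1 / (c + 1)) * a) := by
          gcongr
          · exact hd 0
          · linarith
end
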